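/- Bijection identity for the factorial Littlewood-Richardson rule: Let n ≥ 1, let θ be a skew diagram, and let μ ⊆ ν be partitions with at most n parts, with l = |ν| − |μ| ≥ 1. Then, in ℤ[a_i, b_i : i ∈ ℤ], Σ_R Σ_{k=1}^{l−1} 𝒮_k^−(R) = Σ_R Σ_{k=2}^{l} 𝒮_k^+(R), where R ranges over all sequences μ = ρ^{(0)} → ρ^{(1)} → ⋯ → ρ^{(l)} = ν of partitions with at most n parts. -/

import Mathlib

open scoped BigOperators

namespace FactorialLR

/-- Column order on cells: right-most column first, top to bottom within a column. -/
def ColLT (a b : ℕ × ℕ) : Prop :=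
  b.2 < a.2 ∨ (a.2 = b.2 ∧ a.1 < b.1)

instance (a b : ℕ × ℕ) : Decidable (ColLT a b) := by
  unfold ColLT; infer_instance

/-- The cells of the skew diagram `θo / θi`. -/
def skewCells (θi θo : YoungDiagram) : Finset (ℕ × ℕ) :=
  θo.cells \ θi.cells

/-- A filling of the cell set `s` with entries in `Fin n` (`0`-based, representing the
`1`-based entries `{1,…,n}`) is semistandard if it weakly increases along rows and strictly
increases down columns. -/
def IsSsyt {n : ℕ} (s : Finset (ℕ × ℕ)) (T : s → Fin n) : Prop :=
  (∀ c c' : s, (c : ℕ × ℕ).1 = (c' : ℕ × ℕ).1 → (c : ℕ × ℕ).2 ≤ (c' : ℕ × ℕ).2 → T c ≤ T c') ∧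
  (∀ c c' : s, (c : ℕ × ℕ).1 < (c' : ℕ × ℕ).1 → (c : ℕ × ℕ).2 = (c' : ℕ × ℕ).2 → T c < T c')

/-- The `n`-tuple `a_ρ = (a_{ρ_1+n}, a_{ρ_2+n-1}, …, a_{ρ_n+1})`; the `i`-th entry
(`0`-based `i`) is `a_{ρ_{i+1}+n-(i+1)+1}`. -/
noncomputable def subA {A : Type} [CommRing A] (n : ℕ) (a : ℤ → A) (ρ : YoungDiagram) :
    Fin n → A :=
  fun i => a ((ρ.rowLen i : ℤ) + (n : ℤ) - (i : ℤ))

/-- `μ → ν` : `ν` is obtained from `μ` by adding a single cell. -/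
def Covers (μ ν : YoungDiagram) : Prop :=
  μ ≤ ν ∧ ν.card = μ.card + 1

/-- Chains `μ = ρ⁽⁰⁾ → ρ⁽¹⁾ → ⋯ → ρ⁽ˡ⁾ = ν` of Young diagrams, encoded as lists. -/
def chainSet (μ ν : YoungDiagram) : Set (List YoungDiagram) :=
  {L | L.Chain' Covers ∧ L.head? = some μ ∧ L.getLast? = some ν}

/-- The row (`0`-based) of the unique cell of `τ / σ`, when `σ → τ`. -/
def stepRow (σ τ : YoungDiagram) : ℕ :=
  (τ.cells \ σ.cells).sup Prod.fst

/-- `skipIdx k t` : the `1`-based index, among `{1,…,l} \ {k}`, of the `t`-th barred cell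
(`t` being `0`-based), for tableaux in `𝒯_k(θ,R)`. -/
def skipIdx (k t : ℕ) : ℕ :=
  if t + 1 < k then t + 1 else t + 2

/-- The index `i` with `ρ⁺(α) = ρ⁽ⁱ⁾` for an unbarred cell `α` preceded by `cnt` barred
cells: `ρ⁺(α) = ρ⁽ᵏ⁾` if `α_{k-1} < α < α_{k+1}` (i.e. `cnt = k − 1`), else `ρ(α)`. -/
def rhoIdxP (k cnt : ℕ) : ℕ :=
  if cnt + 1 < k then cnt else if cnt + 1 = k then k else cnt + 1

/-- The index `i` with `ρ⁻(α) = ρ⁽ⁱ⁾`: `ρ⁻(α) = ρ⁽ᵏ⁻¹⁾` if `α_{k-1} < α < α_{k+1}`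
(i.e. `cnt = k − 1`), else `ρ(α)`. -/
def rhoIdxM (k cnt : ℕ) : ℕ :=
  if cnt + 1 < k then cnt else if cnt + 1 = k then k - 1 else cnt + 1

/-- The set `𝒯_k(θ,R)`: pairs `(T,β)` where `T` is a semistandard filling of `s` and `β`
lists the barred cells `α_1 < ⋯ < α_{k-1} < α_{k+1} < ⋯ < α_l` in column order, with
`T(α_i) = r_i` for all `i ≠ k`. -/
def TkSet {n : ℕ} (s : Finset (ℕ × ℕ)) (L : List YoungDiagram) (k : ℕ) :
    Set ((s → Fin n) × (Fin (L.length - 1 - 1) → s)) :=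
  {p | IsSsyt s p.1 ∧
    (∀ i j : Fin (L.length - 1 - 1), i < j → ColLT (p.2 i : ℕ × ℕ) (p.2 j : ℕ × ℕ)) ∧
    (∀ t : Fin (L.length - 1 - 1),
      (p.1 (p.2 t) : ℕ) =
        stepRow (L.getD (skipIdx k (t : ℕ) - 1) ⊥) (L.getD (skipIdx k (t : ℕ)) ⊥))}

/-- `𝒮_k^+(R)` (for `pl = true`), resp. `𝒮_k^-(R)` (for `pl = false`):
`Σ_{T ∈ 𝒯_k(θ,R)} ∏_{α unbarred} ((a_{ρ^±(α)})_{T(α)} − b_{T(α)+c(α)})`. -/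
noncomputable def Skbar (pl : Bool) {A : Type} [CommRing A] (n : ℕ) (s : Finset (ℕ × ℕ))
    (a b : ℤ → A) (L : List YoungDiagram) (k : ℕ) : A :=
  ∑ᶠ p ∈ TkSet (n := n) s L k,
    ∏ c : s,
      if ∃ t, p.2 t = c then 1
      else subA n a
          (L.getD ((if pl then rhoIdxP else rhoIdxM) k
            ((Finset.univ.filter
              (fun t : Fin (L.length - 1 - 1) =>
                ColLT (p.2 t : ℕ × ℕ) (c : ℕ × ℕ))).card)) ⊥)
          (p.1 c)
        - b ((p.1 c : ℤ) + 1 + ((c : ℕ × ℕ).2 : ℤ) - ((c : ℕ × ℕ).1 : ℤ))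

structure Geo {ι : Type} [LinearOrder ι] (rw cl : ι → ℕ) : Prop where
  ord : ∀ c d, c < d ↔ cl d < cl c ∨ (cl c = cl d ∧ rw c < rw d)
  conv : ∀ c d i j, rw c ≤ i → i ≤ rw d → cl c ≤ j → j ≤ cl d → ∃ e, rw e = i ∧ cl e = j

section BK
variable {ι : Type} [LinearOrder ι] {rw cl : ι → ℕ}

theorem Geo.inj (G : Geo rw cl) {c d : ι} (h1 : rw c = rw d) (h2 : cl c = cl d) : c = d := by
  rcases lt_trichotomy c d with h | h | h
  · rw [G.ord] at h; omega
  · exact h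
  · rw [G.ord] at h; omega

def Ss {n : ℕ} (rw cl : ι → ℕ) (T : ι → Fin n) : Prop :=
  (∀ c d, rw c = rw d → cl c ≤ cl d → T c ≤ T d) ∧
  (∀ c d, rw c < rw d → cl c = cl d → T c < T d)

/-- Hole configurations. -/
structure Cfg {n : ℕ} (rw cl : ι → ℕ) (W : Finset ι) (T0 : ι → Fin n) (lo hi : Fin n)
    (T : ι → Fin n) (α : ι) : Prop where
  memW : α ∈ W
  off : ∀ c, c ∉ W → T c = T0 c
  val : T α = hi
  row : ∀ c d, c ≠ α → d ≠ α → rw c = rw d → cl c ≤ cl d →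
    ¬ (rw c = rw α ∧ cl c < cl α ∧ cl α < cl d) → (T c : ℕ) ≤ T d
  col : ∀ c d, c ≠ α → d ≠ α → rw c < rw d → cl c = cl d → (T c : ℕ) < T d
  left : ∀ c, rw c = rw α → cl c < cl α → (T c : ℕ) ≤ hi
  right : ∀ c, rw c = rw α → cl α < cl c → (lo : ℕ) ≤ T c
  up : ∀ c, cl c = cl α → rw c < rw α → (T c : ℕ) ≤ lo
  down : ∀ c, cl c = cl α → rw α < rw c → (hi : ℕ) ≤ T c
  nud : ¬ ((∃ c, cl c = cl α ∧ rw c < rw α ∧ T c = lo) ∧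
    (∃ c, cl c = cl α ∧ rw α < rw c ∧ T c = hi))

variable {n : ℕ} {W : Finset ι} {T0 : ι → Fin n} {lo hi : Fin n} {T : ι → Fin n} {α : ι}

def HL (rw cl : ι → ℕ) (hi : Fin n) (T : ι → Fin n) (α : ι) : Prop :=
  ∃ c, rw c = rw α ∧ cl c < cl α ∧ T c = hi
def HR (rw cl : ι → ℕ) (lo : Fin n) (T : ι → Fin n) (α : ι) : Prop :=
  ∃ c, rw c = rw α ∧ cl α < cl c ∧ T c = lo
def HU (rw cl : ι → ℕ) (lo : Fin n) (T : ι → Fin n) (α : ι) : Prop :=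
  ∃ c, cl c = cl α ∧ rw c < rw α ∧ T c = lo
def HD (rw cl : ι → ℕ) (hi : Fin n) (T : ι → Fin n) (α : ι) : Prop :=
  ∃ c, cl c = cl α ∧ rw α < rw c ∧ T c = hi

theorem Cfg.nLD (G : Geo rw cl) (h : Cfg rw cl W T0 lo hi T α) (hL : HL rw cl hi T α)
    (hD : HD rw cl hi T α) : False := by
  obtain ⟨c, c1, c2, c3⟩ := hL
  obtain ⟨d, d1, d2, d3⟩ := hD
  obtain ⟨e, e1, e2⟩ := G.conv c d (rw d) (cl c) (by omega) le_rfl le_rfl (by omega)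
  have n1 : c ≠ α := by rintro rfl; omega
  have n2 : d ≠ α := by rintro rfl; omega
  have n3 : e ≠ α := by rintro rfl; omega
  have h1 := h.col c e n1 n3 (by omega) (by omega)
  have h2 := h.row e d n3 n2 (by omega) (by omega) (by omega)
  rw [c3] at h1; rw [d3] at h2; omega

theorem Cfg.nRU (G : Geo rw cl) (h : Cfg rw cl W T0 lo hi T α) (hL : HR rw cl lo T α)
    (hD : HU rw cl lo T α) : False := by
  obtain ⟨c, c1, c2, c3⟩ := hL
  obtain ⟨d, d1, d2, d3⟩ := hD
  obtain ⟨e, e1, e2⟩ := G.conv d c (rw d) (cl c) le_rfl (by omega) (by omega) le_rfl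
  have n1 : c ≠ α := by rintro rfl; omega
  have n2 : d ≠ α := by rintro rfl; omega
  have n3 : e ≠ α := by rintro rfl; omega
  have h1 := h.col e c n3 n1 (by omega) (by omega)
  have h2 := h.row d e n2 n3 (by omega) (by omega) (by omega)
  rw [c3] at h1; rw [d3] at h2; omega

open Classical in
noncomputable def nb (rw cl : ι → ℕ) (i j : ℕ) (α : ι) : ι :=
  if h : ∃ e, rw e = i ∧ cl e = j then h.choose else α

theorem Geo.nb_eq (G : Geo rw cl) {i j : ℕ} {α e : ι} (h1 : rw e = i) (h2 : cl e = j) :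
    nb rw cl i j α = e := by
  have h : ∃ e, rw e = i ∧ cl e = j := ⟨e, h1, h2⟩
  unfold nb
  rw [dif_pos h]
  exact G.inj (by rw [h.choose_spec.1, h1]) (by rw [h.choose_spec.2, h2])

theorem Cfg.nbL (G : Geo rw cl) (h : Cfg rw cl W T0 lo hi T α) (hL : HL rw cl hi T α) :
    ∃ b, rw b = rw α ∧ cl b + 1 = cl α ∧ T b = hi := by
  obtain ⟨c, c1, c2, c3⟩ := hL
  obtain ⟨e, e1, e2⟩ := G.conv c α (rw α) (cl α - 1) (by omega) (by omega) (by omega) (by omega)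
  have n1 : c ≠ α := by rintro rfl; omega
  have n3 : e ≠ α := by rintro rfl; omega
  have h1 := h.row c e n1 n3 (by omega) (by omega) (by omega)
  have h2 := h.left e (by omega) (by omega)
  rw [c3] at h1
  exact ⟨e, e1, by omega, Fin.ext (by omega)⟩

theorem Cfg.nbR (G : Geo rw cl) (h : Cfg rw cl W T0 lo hi T α) (hL : HR rw cl lo T α) :
    ∃ b, rw b = rw α ∧ cl b = cl α + 1 ∧ T b = lo := by
  obtain ⟨c, c1, c2, c3⟩ := hL
  obtain ⟨e, e1, e2⟩ := G.conv α c (rw α) (cl α + 1) (by omega) (by omega) (by omega) (by omega)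
  have n1 : c ≠ α := by rintro rfl; omega
  have n3 : e ≠ α := by rintro rfl; omega
  have h1 := h.row e c n3 n1 (by omega) (by omega) (by omega)
  have h2 := h.right e (by omega) (by omega)
  rw [c3] at h1
  exact ⟨e, e1, by omega, Fin.ext (by omega)⟩

theorem Cfg.nbU (G : Geo rw cl) (h : Cfg rw cl W T0 lo hi T α) (hL : HU rw cl lo T α) :
    ∃ b, rw b + 1 = rw α ∧ cl b = cl α ∧ T b = lo := by
  obtain ⟨c, c1, c2, c3⟩ := hL
  obtain ⟨e, e1, e2⟩ := G.conv c α (rw α - 1) (cl α) (by omega) (by omega) (by omega) (by omega)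
  have n1 : c ≠ α := by rintro rfl; omega
  have n3 : e ≠ α := by rintro rfl; omega
  have h2 := h.up e (by omega) (by omega)
  by_cases hce : c = e
  · subst hce; exact ⟨c, by omega, by omega, c3⟩
  have : rw c ≠ rw e := fun hh => hce (G.inj hh (by omega))
  have h1 := h.col c e n1 n3 (by omega) (by omega)
  rw [c3] at h1
  exact ⟨e, by omega, by omega, Fin.ext (by omega)⟩

theorem Cfg.nbD (G : Geo rw cl) (h : Cfg rw cl W T0 lo hi T α) (hL : HD rw cl hi T α) :
    ∃ b, rw b = rw α + 1 ∧ cl b = cl α ∧ T b = hi := by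
  obtain ⟨c, c1, c2, c3⟩ := hL
  obtain ⟨e, e1, e2⟩ := G.conv α c (rw α + 1) (cl α) (by omega) (by omega) (by omega) (by omega)
  have n1 : c ≠ α := by rintro rfl; omega
  have n3 : e ≠ α := by rintro rfl; omega
  have h2 := h.down e (by omega) (by omega)
  by_cases hce : c = e
  · subst hce; exact ⟨c, by omega, by omega, c3⟩
  have : rw c ≠ rw e := fun hh => hce (G.inj hh (by omega))
  have h1 := h.col e c n3 n1 (by omega) (by omega)
  rw [c3] at h1
  exact ⟨e, by omega, by omega, Fin.ext (by omega)⟩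

/-- left move -/
theorem Cfg.moveL (G : Geo rw cl) (hlh : (hi : ℕ) = lo + 1) (hW : ∀ c d, c ∈ W → c < d → d ∈ W)
    (h : Cfg rw cl W T0 lo hi T α) (hU : ¬ HU rw cl lo T α) {b : ι}
    (b1 : rw b = rw α) (b2 : cl b + 1 = cl α) (b3 : T b = hi) :
    Cfg rw cl W T0 lo hi (Function.update T α lo) b ∧
    HR rw cl lo (Function.update T α lo) b ∧ ¬ HD rw cl hi (Function.update T α lo) b := by
  have nb : b ≠ α := by rintro rfl; omega
  have key : ∀ c, (Function.update T α lo c = lo ∧ c = α) ∨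
      (Function.update T α lo c = T c ∧ c ≠ α) := by
    intro c; by_cases hc : c = α
    · subst hc; simp
    · simp [hc]
  have hbelow : ∀ c, cl c = cl b → rw b < rw c → (hi : ℕ) < T c := by
    intro c h1 h2
    have := h.col b c nb (by rintro rfl; omega) h2 h1.symm
    rwa [b3] at this
  have hnD : ¬ HD rw cl hi (Function.update T α lo) b := by
    rintro ⟨c, c1, c2, c3⟩
    have := hbelow c c1 c2
    rcases key c with ⟨k, rfl⟩ | ⟨k, k'⟩
    · omega
    · rw [k] at c3; rw [c3] at this; omega
  refine ⟨⟨hW α b h.memW ((G.ord _ _).2 (by omega)), ?_, ?_, ?_, ?_, ?_, ?_, ?_, ?_, ?_⟩, ?_, hnD⟩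
  · intro c hc
    rcases key c with ⟨k, rfl⟩ | ⟨k, k'⟩
    · exact absurd h.memW hc
    · rw [k]; exact h.off c hc
  · rw [Function.update_of_ne nb, b3]
  · intro c d hc hd h1 h2 h3
    rcases key c with ⟨k, rfl⟩ | ⟨k, k'⟩ <;> rcases key d with ⟨k2, rfl⟩ | ⟨k2, k2'⟩ <;> simp only [k, k2]
    · exact le_rfl
    · have : cl c ≠ cl d := fun hh => k2' (G.inj h1.symm hh.symm)
      exact h.right d h1.symm (by omega)
    · exfalso
      have : cl c ≠ cl b := fun hh => hc (G.inj (by omega) hh)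
      have : cl c ≠ cl d := fun hh => k' (G.inj (by omega) hh)
      omega
    · apply h.row c d k' k2' h1 h2
      rintro ⟨h4, h5, h6⟩
      have : cl c ≠ cl b := fun hh => hc (G.inj (by omega) hh)
      omega
  · intro c d hc hd h1 h2
    rcases key c with ⟨k, rfl⟩ | ⟨k, k'⟩ <;> rcases key d with ⟨k2, rfl⟩ | ⟨k2, k2'⟩ <;> simp only [k, k2]
    · omega
    · have := h.down d h2.symm h1; omega
    · have := h.up c h2 h1
      have h5 : T c ≠ lo := fun hh => hU ⟨c, h2, h1, hh⟩
      have : (T c : ℕ) ≠ lo := fun hh => h5 (Fin.ext hh)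
      omega
    · exact h.col c d k' k2' h1 h2
  · intro c h1 h2
    rcases key c with ⟨k, rfl⟩ | ⟨k, k'⟩ <;> rw [k]
    · omega
    · exact h.left c (by omega) (by omega)
  · intro c h1 h2
    rcases key c with ⟨k, rfl⟩ | ⟨k, k'⟩ <;> rw [k]
    have : cl c ≠ cl α := fun hh => k' (G.inj (by omega) hh)
    exact h.right c (by omega) (by omega)
  · intro c h1 h2
    rcases key c with ⟨k, rfl⟩ | ⟨k, k'⟩ <;> rw [k]
    have := h.col c b k' nb h2 h1
    rw [b3] at this; omega
  · intro c h1 h2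
    rcases key c with ⟨k, rfl⟩ | ⟨k, k'⟩ <;> rw [k]
    · omega
    · exact (hbelow c h1 h2).le
  · rintro ⟨-, h2⟩; exact hnD h2
  · exact ⟨α, b1.symm, by omega, by simp⟩

/-- right move -/
theorem Cfg.moveR (G : Geo rw cl) (hlh : (hi : ℕ) = lo + 1)
    (h : Cfg rw cl W T0 lo hi T α) (hD : ¬ HD rw cl hi T α) {b : ι} (hb : b ∈ W)
    (b1 : rw b = rw α) (b2 : cl b = cl α + 1) (b3 : T b = lo) :
    Cfg rw cl W T0 lo hi (Function.update T b hi) b ∧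
    HL rw cl hi (Function.update T b hi) b ∧ ¬ HU rw cl lo (Function.update T b hi) b := by
  have nb : b ≠ α := by rintro rfl; omega
  have key : ∀ c, c ≠ b → Function.update T b hi c = T c := fun c hc => Function.update_of_ne hc _ _
  have habove : ∀ c, cl c = cl b → rw c < rw b → (T c : ℕ) < lo := by
    intro c h1 h2
    have := h.col c b (by rintro rfl; omega) nb h2 h1
    rwa [b3] at this
  have hnU : ¬ HU rw cl lo (Function.update T b hi) b := by
    rintro ⟨c, c1, c2, c3⟩
    have := habove c c1 c2
    rw [key c (by rintro rfl; omega)] at c3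
    rw [c3] at this; omega
  have hv := h.val
  refine ⟨⟨hb, ?_, by simp, ?_, ?_, ?_, ?_, ?_, ?_, ?_⟩, ?_, hnU⟩
  · intro c hc
    rw [key c (by rintro rfl; exact hc hb)]; exact h.off c hc
  · intro c d hc hd h1 h2 h3
    rw [key c hc, key d hd]
    by_cases hca : c = α <;> by_cases hda : d = α
    · subst hca; subst hda; omega
    · subst hca
      exfalso
      have : cl d ≠ cl b := fun hh => hd (G.inj (by omega) hh)
      have : cl d ≠ cl c := fun hh => hda (G.inj (by omega) hh)
      omega
    · subst hda; rw [hv]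
      have : cl c ≠ cl d := fun hh => hca (G.inj (by omega) hh)
      exact h.left c h1 (by omega)
    · apply h.row c d hca hda h1 h2
      rintro ⟨h4, h5, h6⟩
      have : cl d ≠ cl b := fun hh => hd (G.inj (by omega) hh)
      omega
  · intro c d hc hd h1 h2
    rw [key c hc, key d hd]
    by_cases hca : c = α <;> by_cases hda : d = α
    · subst hca; subst hda; omega
    · subst hca
      rw [hv]
      have := h.down d h2.symm h1
      have h5 : T d ≠ hi := fun hh => hD ⟨d, h2.symm, h1, hh⟩
      have : (T d : ℕ) ≠ hi := fun hh => h5 (Fin.ext hh)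
      omega
    · subst hda; rw [hv]
      have := h.up c h2 h1; omega
    · exact h.col c d hca hda h1 h2
  · intro c h1 h2
    rw [key c (by rintro rfl; omega)]
    by_cases hca : c = α
    · subst hca; rw [hv]
    · have : cl c ≠ cl α := fun hh => hca (G.inj (by omega) hh)
      exact h.left c (by omega) (by omega)
  · intro c h1 h2
    rw [key c (by rintro rfl; omega)]
    exact h.right c (by omega) (by omega)
  · intro c h1 h2
    rw [key c (by rintro rfl; omega)]
    exact (habove c h1 h2).le
  · intro c h1 h2
    rw [key c (by rintro rfl; omega)]
    have := h.col b c nb (by rintro rfl; omega) h2 h1.symm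
    rw [b3] at this; omega
  · rintro ⟨h2, -⟩; exact hnU h2
  · exact ⟨α, b1.symm, by omega, by rw [key α nb.symm, hv]⟩

/-- up move -/
theorem Cfg.moveU (G : Geo rw cl) (hlh : (hi : ℕ) = lo + 1)
    (h : Cfg rw cl W T0 lo hi T α) {b : ι} (hb : b ∈ W)
    (b1 : rw b + 1 = rw α) (b2 : cl b = cl α) (b3 : T b = lo) :
    Cfg rw cl W T0 lo hi (Function.update T b hi) b ∧
    HD rw cl hi (Function.update T b hi) b := by
  have nb : b ≠ α := by rintro rfl; omega
  have hU : HU rw cl lo T α := ⟨b, b2, by omega, b3⟩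
  have hD : ¬ HD rw cl hi T α := fun hh => h.nud ⟨hU, hh⟩
  have hR : ¬ HR rw cl lo T α := fun hh => h.nRU G hh hU
  have key : ∀ c, c ≠ b → Function.update T b hi c = T c := fun c hc => Function.update_of_ne hc _ _
  have habove : ∀ c, cl c = cl b → rw c < rw b → (T c : ℕ) < lo := by
    intro c h1 h2
    have := h.col c b (by rintro rfl; omega) nb h2 h1
    rwa [b3] at this
  have hnU : ¬ HU rw cl lo (Function.update T b hi) b := by
    rintro ⟨c, c1, c2, c3⟩
    have := habove c c1 c2
    rw [key c (by rintro rfl; omega)] at c3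
    rw [c3] at this; omega
  have hv := h.val
  refine ⟨⟨hb, ?_, by simp, ?_, ?_, ?_, ?_, ?_, ?_, ?_⟩, ?_⟩
  · intro c hc
    rw [key c (by rintro rfl; exact hc hb)]; exact h.off c hc
  · intro c d hc hd h1 h2 h3
    rw [key c hc, key d hd]
    by_cases hca : c = α <;> by_cases hda : d = α
    · subst hca; subst hda; omega
    · subst hca; rw [hv]
      have : cl d ≠ cl c := fun hh => hda (G.inj (by omega) hh)
      have := h.right d (by omega) (by omega)
      have h5 : T d ≠ lo := fun hh => hR ⟨d, by omega, by omega, hh⟩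
      have : (T d : ℕ) ≠ lo := fun hh => h5 (Fin.ext hh)
      omega
    · subst hda; rw [hv]
      have : cl c ≠ cl d := fun hh => hca (G.inj (by omega) hh)
      exact h.left c h1 (by omega)
    · by_contra hcon
      refine hcon (h.row c d hca hda h1 h2 ?_)
      rintro ⟨h4, h5, h6⟩
      have h7 := h.left c h4 h5
      obtain ⟨e, e1, e2⟩ := G.conv b d (rw b) (cl d) le_rfl (by omega) (by omega) le_rfl
      have ea : e ≠ α := by rintro rfl; omega
      have q1 := h.row b e nb ea (by omega) (by omega) (by omega)
      have q2 := h.col e d ea hda (by omega) (by omega)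
      rw [b3] at q1
      omega
  · intro c d hc hd h1 h2
    rw [key c hc, key d hd]
    by_cases hca : c = α <;> by_cases hda : d = α
    · subst hca; subst hda; omega
    · subst hca
      rw [hv]
      have := h.down d h2.symm h1
      have h5 : T d ≠ hi := fun hh => hD ⟨d, h2.symm, h1, hh⟩
      have : (T d : ℕ) ≠ hi := fun hh => h5 (Fin.ext hh)
      omega
    · subst hda; rw [hv]
      have := h.up c h2 h1; omega
    · exact h.col c d hca hda h1 h2
  · intro c h1 h2
    rw [key c (by rintro rfl; omega)]
    have := h.row c b (by rintro rfl; omega) nb h1 h2.le (by omega)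
    rw [b3] at this; omega
  · intro c h1 h2
    rw [key c (by rintro rfl; omega)]
    have := h.row b c nb (by rintro rfl; omega) h1.symm h2.le (by omega)
    rw [b3] at this; omega
  · intro c h1 h2
    rw [key c (by rintro rfl; omega)]
    exact (habove c h1 h2).le
  · intro c h1 h2
    rw [key c (by rintro rfl; omega)]
    by_cases hca : c = α
    · subst hca; rw [hv]
    · have : rw c ≠ rw α := fun hh => hca (G.inj hh (by omega))
      exact h.down c (by omega) (by omega)
  · rintro ⟨h2, -⟩; exact hnU h2
  · exact ⟨α, b2.symm, by omega, by rw [key α nb.symm, hv]⟩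

/-- down move -/
theorem Cfg.moveD (G : Geo rw cl) (hlh : (hi : ℕ) = lo + 1) (hW : ∀ c d, c ∈ W → c < d → d ∈ W)
    (h : Cfg rw cl W T0 lo hi T α) {b : ι}
    (b1 : rw b = rw α + 1) (b2 : cl b = cl α) (b3 : T b = hi) :
    Cfg rw cl W T0 lo hi (Function.update T α lo) b ∧
    HU rw cl lo (Function.update T α lo) b := by
  have nb : b ≠ α := by rintro rfl; omega
  have hD : HD rw cl hi T α := ⟨b, b2, by omega, b3⟩
  have hU : ¬ HU rw cl lo T α := fun hh => h.nud ⟨hh, hD⟩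
  have hL : ¬ HL rw cl hi T α := fun hh => h.nLD G hh hD
  have hL' : ∀ c, rw c = rw α → cl c < cl α → (T c : ℕ) ≤ lo := by
    intro c h1 h2
    have := h.left c h1 h2
    have h5 : T c ≠ hi := fun hh => hL ⟨c, h1, h2, hh⟩
    have : (T c : ℕ) ≠ hi := fun hh => h5 (Fin.ext hh)
    omega
  have key : ∀ c, (Function.update T α lo c = lo ∧ c = α) ∨
      (Function.update T α lo c = T c ∧ c ≠ α) := by
    intro c; by_cases hc : c = α
    · subst hc; simp
    · simp [hc]
  have hbelow : ∀ c, cl c = cl b → rw b < rw c → (hi : ℕ) < T c := by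
    intro c h1 h2
    have := h.col b c nb (by rintro rfl; omega) h2 h1.symm
    rwa [b3] at this
  have hnD : ¬ HD rw cl hi (Function.update T α lo) b := by
    rintro ⟨c, c1, c2, c3⟩
    have := hbelow c c1 c2
    rcases key c with ⟨k, rfl⟩ | ⟨k, k'⟩
    · omega
    · rw [k] at c3; rw [c3] at this; omega
  refine ⟨⟨hW α b h.memW ((G.ord _ _).2 (by omega)), ?_, ?_, ?_, ?_, ?_, ?_, ?_, ?_, ?_⟩, ?_⟩
  · intro c hc
    rcases key c with ⟨k, rfl⟩ | ⟨k, k'⟩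
    · exact absurd h.memW hc
    · rw [k]; exact h.off c hc
  · rw [Function.update_of_ne nb, b3]
  · intro c d hc hd h1 h2 h3
    rcases key c with ⟨k, rfl⟩ | ⟨k, k'⟩ <;> rcases key d with ⟨k2, rfl⟩ | ⟨k2, k2'⟩ <;> simp only [k, k2]
    · exact le_rfl
    · have : cl c ≠ cl d := fun hh => k2' (G.inj h1.symm hh.symm)
      exact h.right d h1.symm (by omega)
    · have : cl c ≠ cl d := fun hh => k' (G.inj (by omega) hh)
      exact hL' c h1 (by omega)
    · by_cases hx : rw c = rw α ∧ cl c < cl α ∧ cl α < cl d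
      · obtain ⟨h4, h5, h6⟩ := hx
        have := hL' c h4 h5
        have := h.right d (by omega) h6
        omega
      · exact h.row c d k' k2' h1 h2 hx
  · intro c d hc hd h1 h2
    rcases key c with ⟨k, rfl⟩ | ⟨k, k'⟩ <;> rcases key d with ⟨k2, rfl⟩ | ⟨k2, k2'⟩ <;> simp only [k, k2]
    · omega
    · have := h.down d h2.symm h1; omega
    · have := h.up c h2 h1
      have h5 : T c ≠ lo := fun hh => hU ⟨c, h2, h1, hh⟩
      have : (T c : ℕ) ≠ lo := fun hh => h5 (Fin.ext hh)
      omega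
    · exact h.col c d k' k2' h1 h2
  · intro c h1 h2
    rcases key c with ⟨k, rfl⟩ | ⟨k, k'⟩ <;> rw [k]
    · omega
    · have := h.row c b k' nb h1 h2.le (by omega)
      rwa [b3] at this
  · intro c h1 h2
    rcases key c with ⟨k, rfl⟩ | ⟨k, k'⟩ <;> rw [k]
    have := h.row b c nb k' h1.symm h2.le (by omega)
    rw [b3] at this; omega
  · intro c h1 h2
    rcases key c with ⟨k, rfl⟩ | ⟨k, k'⟩ <;> rw [k]
    have : rw c ≠ rw α := fun hh => k' (G.inj hh (by omega))
    exact h.up c (by omega) (by omega)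
  · intro c h1 h2
    rcases key c with ⟨k, rfl⟩ | ⟨k, k'⟩ <;> rw [k]
    · omega
    · exact (hbelow c h1 h2).le
  · rintro ⟨-, h2⟩; exact hnD h2
  · exact ⟨α, b2.symm, by omega, by simp⟩

end BK

section BK2
variable {ι : Type} [LinearOrder ι] {rw cl : ι → ℕ}
variable {n : ℕ} {W : Finset ι} {T0 : ι → Fin n} {lo hi : Fin n} {T : ι → Fin n} {α : ι}
variable {K : Type} [CommRing K]

/-- factor of a cell -/
def fac (rw cl : ι → ℕ) (u : Fin n → K) (b : ℤ → K) (v : Fin n) (c : ι) : K :=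
  u v - b ((v : ℤ) + 1 + (cl c : ℤ) - (rw c : ℤ))

def hwt (rw cl : ι → ℕ) (u u' : Fin n → K) (b : ℤ → K) (W : Finset ι) (p : (ι → Fin n) × ι) : K :=
  ∏ c ∈ W, if c < p.2 then fac rw cl u b (p.1 c) c else
    if c = p.2 then 1 else fac rw cl u' b (p.1 c) c

theorem hwt_move (u : Fin n → K) (b : ℤ → K) (T : ι → Fin n) {α β : ι}
    (hα : α ∈ W) (hβ : β ∈ W) (hab : α < β) (hT : T β = hi)
    (hc : (lo : ℤ) + 1 + (cl α : ℤ) - (rw α : ℤ) = (hi : ℤ) + 1 + (cl β : ℤ) - (rw β : ℤ))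
    (hbet : ∀ c, α < c → c < β → T c ≠ lo ∧ T c ≠ hi) :
    hwt rw cl u (u ∘ Equiv.swap lo hi) b W (T, α) =
    hwt rw cl u (u ∘ Equiv.swap lo hi) b W (Function.update T α lo, β) := by
  have hβ' : β ∈ W.erase α := Finset.mem_erase.2 ⟨hab.ne', hβ⟩
  unfold hwt
  rw [← Finset.mul_prod_erase W _ hα, ← Finset.mul_prod_erase (W.erase α) _ hβ',
    ← Finset.mul_prod_erase W _ hα, ← Finset.mul_prod_erase (W.erase α) _ hβ', ← mul_assoc, ← mul_assoc]
  congr 1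
  · simp only [lt_irrefl, if_true, if_false, hab, hab.not_gt, hab.ne', Function.update_self, hT, fac,
      Function.comp, Equiv.swap_apply_right, hc]
    simp
  · apply Finset.prod_congr rfl
    intro c hc
    simp only [Finset.mem_erase] at hc
    obtain ⟨c1, c2, c3⟩ := hc
    simp only [Function.update_of_ne c2, c1, c2, if_false]
    rcases lt_trichotomy c α with h | h | h
    · simp [h, h.trans hab]
    · exact absurd h c2
    · by_cases h2 : c < β
      · simp only [h.not_gt, h2, if_true, if_false, fac, Function.comp]
        obtain ⟨q1, q2⟩ := hbet c h h2
        rw [Equiv.swap_apply_of_ne_of_ne q1 q2]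
      · simp [h.not_gt, h2]

theorem tele_comm (u u' : Fin n → K) (b : ℤ → K) (W : Finset ι) (T : ι → Fin n) :
    ∏ c ∈ W, fac rw cl u b (T c) c - ∏ c ∈ W, fac rw cl u' b (T c) c =
    ∑ α ∈ W, (u (T α) - u' (T α)) * hwt rw cl u u' b W (T, α) := by
  have := Finset.prod_add_ordered W (fun c => fac rw cl u' b (T c) c)
    (fun c => u (T c) - u' (T c))
  have e : ∀ c, fac rw cl u' b (T c) c + (u (T c) - u' (T c)) = fac rw cl u b (T c) c := by
    intro c; unfold fac; ring
  simp only [e] at this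
  rw [this, add_sub_cancel_left]
  apply Finset.sum_congr rfl
  intro α hα
  rw [mul_assoc]; congr 1
  unfold hwt
  rw [← Finset.mul_prod_erase W _ hα]
  simp only [lt_irrefl, if_true, if_false, one_mul]
  rw [← Finset.prod_filter_mul_prod_filter_not (W.erase α) (fun c => c < α)]
  congr 1
  · apply Finset.prod_congr
    · ext c; simp only [Finset.mem_filter, Finset.mem_erase]
      exact ⟨fun h => ⟨⟨h.2.ne, h.1⟩, h.2⟩, fun h => ⟨h.1.2, h.2⟩⟩
    · intro c hc; simp only [Finset.mem_filter] at hc; simp [hc.2]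
  · apply Finset.prod_congr
    · ext c; simp only [Finset.mem_filter, Finset.mem_erase]
      exact ⟨fun h => ⟨⟨h.2.ne', h.1⟩, h.2.not_gt⟩, fun h => ⟨h.1.2, lt_of_le_of_ne (not_lt.1 h.2) h.1.1.symm⟩⟩
    · intro c hc; simp only [Finset.mem_filter, Finset.mem_erase] at hc; simp [hc.2, hc.1.1]

variable [Fintype ι]

open Classical in
theorem sum_cfg (G : Geo rw cl) (hlh : (hi : ℕ) = lo + 1) (hW : ∀ c d, c ∈ W → c < d → d ∈ W)
    (hQ : W = Finset.univ ∨ ∃ α0, W = Finset.univ.filter (α0 < ·) ∧ T0 α0 = hi)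
    (u : Fin n → K) (b : ℤ → K) :
    ∑ p : (ι → Fin n) × ι with Ss rw cl p.1 ∧ (∀ c ∉ W, p.1 c = T0 c) ∧ p.2 ∈ W ∧ p.1 p.2 = hi,
      hwt rw cl u (u ∘ Equiv.swap lo hi) b W p =
    ∑ p : (ι → Fin n) × ι with Ss rw cl p.1 ∧ (∀ c ∉ W, p.1 c = T0 c) ∧ p.2 ∈ W ∧ p.1 p.2 = lo,
      hwt rw cl u (u ∘ Equiv.swap lo hi) b W p := by
  set w := hwt rw cl u (u ∘ Equiv.swap lo hi) b W with hw
  let C (p : (ι → Fin n) × ι) : Prop := Cfg rw cl W T0 lo hi p.1 p.2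
  let L (p : (ι → Fin n) × ι) : Prop := HL rw cl hi p.1 p.2
  let R (p : (ι → Fin n) × ι) : Prop := HR rw cl lo p.1 p.2
  let U (p : (ι → Fin n) × ι) : Prop := HU rw cl lo p.1 p.2
  let D (p : (ι → Fin n) × ι) : Prop := HD rw cl hi p.1 p.2
  have lohi : lo ≠ hi := by intro h; rw [h] at hlh; omega
  -- boundary
  have bU : ∀ (T : ι → Fin n) α b, Cfg rw cl W T0 lo hi T α → rw b + 1 = rw α → cl b = cl α →
      T b = lo → b ∈ W := by
    intro T α b h b1 b2 b3
    rcases hQ with rfl | ⟨α0, rfl, h0⟩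
    · simp
    · have hα := h.memW
      have h1 := h.off α0 (by simp)
      simp only [Finset.mem_filter, Finset.mem_univ, true_and] at hα ⊢
      by_contra hb
      have hne : b ≠ α0 := by rintro rfl; exact lohi (by rw [← b3, h1, h0])
      have hb' : b < α0 := lt_of_le_of_ne (not_lt.1 hb) hne
      rw [G.ord] at hb' hα
      omega
  have bR : ∀ (T : ι → Fin n) α b, Cfg rw cl W T0 lo hi T α → ¬ HD rw cl hi T α → rw b = rw α →
      cl b = cl α + 1 → T b = lo → b ∈ W := by
    intro T α b h hD b1 b2 b3
    rcases hQ with rfl | ⟨α0, rfl, h0⟩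
    · simp
    · have hα := h.memW
      have h1 := h.off α0 (by simp)
      rw [h0] at h1
      simp only [Finset.mem_filter, Finset.mem_univ, true_and] at hα ⊢
      by_contra hb
      have hne : b ≠ α0 := by rintro rfl; exact lohi (by rw [← b3, h1])
      have hb' : b < α0 := lt_of_le_of_ne (not_lt.1 hb) hne
      rw [G.ord] at hb' hα
      rcases hα with hα | hα
      · obtain ⟨e, e1, e2⟩ := G.conv α α0 (rw α0) (cl α) (by omega) le_rfl le_rfl (by omega)
        have q1 := h.row e α0 (by rintro rfl; omega) (by rintro rfl; omega) e1 (by omega) (by omega)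
        have q2 := h.down e e2 (by omega)
        rw [h1] at q1
        exact hD ⟨e, e2, by omega, Fin.ext (by omega)⟩
      · have := h.up α0 (by omega) (by omega)
        rw [h1] at this; omega
  have sA : ∑ p : (ι → Fin n) × ι with Ss rw cl p.1 ∧ (∀ c ∉ W, p.1 c = T0 c) ∧ p.2 ∈ W ∧ p.1 p.2 = hi, w p
      = ∑ p with (C p ∧ ¬ D p ∧ ¬ R p), w p := by
    apply Finset.sum_congr _ (fun _ _ => rfl)
    apply Finset.filter_congr
    rintro ⟨T, α⟩ -
    change (Ss rw cl T ∧ (∀ c ∉ W, T c = T0 c) ∧ α ∈ W ∧ T α = hi) ↔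
      (Cfg rw cl W T0 lo hi T α ∧ ¬ HD rw cl hi T α ∧ ¬ HR rw cl lo T α)
    constructor
    · rintro ⟨⟨h1, h2⟩, h3, h4, h5⟩
      (try simp only at h3 h4 h5)
      have hD : ¬ HD rw cl hi T α := by
        rintro ⟨c, c1, c2, c3⟩
        have := h2 α c c2 c1.symm
        (try simp only at c3)
        rw [c3, h5] at this; exact lt_irrefl _ this
      refine ⟨⟨h4, h3, h5, ?_, ?_, ?_, ?_, ?_, ?_, ?_⟩, hD, ?_⟩
      · intro c d _ _ q1 q2 _; exact h1 c d q1 q2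
      · intro c d _ _ q1 q2; exact h2 c d q1 q2
      · intro c q1 q2; have := h1 c α q1 q2.le; (try simp only); rw [h5] at this; exact this
      · intro c q1 q2; have := h1 α c q1.symm q2.le; (try simp only); rw [h5] at this
        have : (hi : ℕ) ≤ T c := this
        omega
      · intro c q1 q2; have := h2 c α q2 q1; (try simp only); rw [h5] at this
        have : (T c : ℕ) < hi := this
        omega
      · intro c q1 q2; have := h2 α c q2 q1.symm; (try simp only); rw [h5] at this
        have : (hi : ℕ) < T c := this
        omega
      · rintro ⟨-, h⟩; exact hD h
      · rintro ⟨c, c1, c2, c3⟩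
        have := h1 α c c1.symm c2.le
        (try simp only at c3)
        rw [c3, h5] at this
        have : (hi : ℕ) ≤ lo := this
        omega
    · rintro ⟨h, hD, hR⟩
      have hv := h.val
      (try simp only at hv)
      have hR' : ∀ c, rw c = rw α → cl α < cl c → (hi : ℕ) ≤ T c := by
        intro c q1 q2
        have := h.right c q1 q2
        have h5 : T c ≠ lo := fun hh => hR ⟨c, q1, q2, hh⟩
        have : (T c : ℕ) ≠ lo := fun hh => h5 (Fin.ext hh)
        (try simp only at *)
        omega
      have hD' : ∀ c, cl c = cl α → rw α < rw c → (hi : ℕ) < T c := by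
        intro c q1 q2
        have := h.down c q1 q2
        have h5 : T c ≠ hi := fun hh => hD ⟨c, q1, q2, hh⟩
        have : (T c : ℕ) ≠ hi := fun hh => h5 (Fin.ext hh)
        (try simp only at *)
        omega
      refine ⟨⟨?_, ?_⟩, h.off, h.memW, h.val⟩
      · intro c d q1 q2
        show (T c : ℕ) ≤ T d
        by_cases hca : c = α <;> by_cases hda : d = α
        · rw [hca, hda]
        · subst hca
          have : cl c ≠ cl d := fun hh => hda (G.inj q1.symm hh.symm)
          rw [hv]; exact hR' d q1.symm (by omega)
        · subst hda
          have : cl c ≠ cl d := fun hh => hca (G.inj q1 hh)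
          rw [hv]; exact h.left c q1 (by (try simp only); omega)
        · by_cases hx : rw c = rw α ∧ cl c < cl α ∧ cl α < cl d
          · obtain ⟨h4, h5, h6⟩ := hx
            have := h.left c h4 h5
            have := hR' d (by omega) h6
            (try simp only at *)
            omega
          · exact h.row c d hca hda q1 q2 hx
      · intro c d q1 q2
        show (T c : ℕ) < T d
        by_cases hca : c = α <;> by_cases hda : d = α
        · rw [hca, hda] at q1; omega
        · subst hca
          rw [hv]; exact hD' d q2.symm q1
        · subst hda
          have := h.up c q2 q1
          rw [hv]; (try simp only at *); omega
        · exact h.col c d hca hda q1 q2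
  have sB : ∑ p : (ι → Fin n) × ι with Ss rw cl p.1 ∧ (∀ c ∉ W, p.1 c = T0 c) ∧ p.2 ∈ W ∧ p.1 p.2 = lo, w p
      = ∑ p with (C p ∧ ¬ U p ∧ ¬ L p), w p := by
    refine Finset.sum_bij' (fun p _ => (Function.update p.1 p.2 hi, p.2))
      (fun p _ => (Function.update p.1 p.2 lo, p.2)) ?_ ?_ ?_ ?_ ?_
    · rintro ⟨T, α⟩ h
      simp only [Finset.mem_filter, Finset.mem_univ, true_and] at h ⊢
      obtain ⟨⟨h1, h2⟩, h3, h4, h5⟩ := h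
      have key : ∀ c, c ≠ α → Function.update T α hi c = T c := fun c hc => Function.update_of_ne hc _ _
      have keyr : ∀ c, cl c ≠ cl α → Function.update T α hi c = T c := 
        fun c hc => key c (by rintro rfl; exact hc rfl)
      have keyc : ∀ c, rw c ≠ rw α → Function.update T α hi c = T c := 
        fun c hc => key c (by rintro rfl; exact hc rfl)
      have hU : ¬ HU rw cl lo (Function.update T α hi) α := by
        rintro ⟨c, c1, c2, c3⟩
        have := h2 c α c2 c1
        (try simp only at c3)
        rw [keyc c c2.ne] at c3
        rw [c3, h5] at this; exact lt_irrefl _ this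
      refine ⟨⟨h4, ?_, by simp, ?_, ?_, ?_, ?_, ?_, ?_, ?_⟩, hU, ?_⟩
      · intro c hc; (try simp only); rw [key c (by rintro rfl; exact hc h4)]; exact h3 c hc
      · intro c d hc hd q1 q2 _; (try simp only at *); rw [key c hc, key d hd]; exact h1 c d q1 q2
      · intro c d hc hd q1 q2; (try simp only at *); rw [key c hc, key d hd]; exact h2 c d q1 q2
      · intro c q1 q2; have := h1 c α q1 q2.le; (try simp only at *); rw [h5] at this; rw [keyr c q2.ne]
        have : (T c : ℕ) ≤ lo := this
        omega
      · intro c q1 q2; have := h1 α c q1.symm q2.le; (try simp only at *); rw [h5] at this; rw [keyr c q2.ne']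
        exact this
      · intro c q1 q2; have := h2 c α q2 q1; (try simp only at *); rw [h5] at this; rw [keyc c q2.ne]
        have : (T c : ℕ) < lo := this
        omega
      · intro c q1 q2; have := h2 α c q2 q1.symm; (try simp only at *); rw [h5] at this; rw [keyc c q2.ne']
        have : (lo : ℕ) < T c := this
        omega
      · rintro ⟨h, -⟩; exact hU h
      · rintro ⟨c, c1, c2, c3⟩
        have := h1 c α c1 c2.le
        (try simp only at c3)
        rw [keyr c c2.ne] at c3
        rw [c3, h5] at this
        have : (hi : ℕ) ≤ lo := this
        omega
    · rintro ⟨T, α⟩ h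
      simp only [Finset.mem_filter, Finset.mem_univ, true_and] at h ⊢
      obtain ⟨h, hU, hL⟩ := h
      have key : ∀ c, c ≠ α → Function.update T α lo c = T c := fun c hc => Function.update_of_ne hc _ _
      have hv := h.val
      (try simp only at hv)
      have hL' : ∀ c, rw c = rw α → cl c < cl α → (T c : ℕ) ≤ lo := by
        intro c q1 q2
        have := h.left c q1 q2
        have h5 : T c ≠ hi := fun hh => hL ⟨c, q1, q2, hh⟩
        have : (T c : ℕ) ≠ hi := fun hh => h5 (Fin.ext hh)
        (try simp only at *)
        omega
      have hU' : ∀ c, cl c = cl α → rw c < rw α → (T c : ℕ) < lo := by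
        intro c q1 q2
        have := h.up c q1 q2
        have h5 : T c ≠ lo := fun hh => hU ⟨c, q1, q2, hh⟩
        have : (T c : ℕ) ≠ lo := fun hh => h5 (Fin.ext hh)
        (try simp only at *)
        omega
      refine ⟨⟨?_, ?_⟩, ?_, h.memW, by simp⟩
      · intro c d q1 q2
        by_cases hca : c = α <;> by_cases hda : d = α
        · rw [hca, hda]
        · subst hca
          have : cl c ≠ cl d := fun hh => hda (G.inj q1.symm hh.symm)
          rw [key d hda, Function.update_self]; exact h.right d q1.symm (by (try simp only); omega)
        · subst hda
          have : cl c ≠ cl d := fun hh => hca (G.inj q1 hh)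
          rw [key c hca, Function.update_self]; exact hL' c q1 (by omega)
        · rw [key c hca, key d hda]
          show (T c : ℕ) ≤ T d
          by_cases hx : rw c = rw α ∧ cl c < cl α ∧ cl α < cl d
          · obtain ⟨h4, h5, h6⟩ := hx
            have := hL' c h4 h5
            have := h.right d (by (try simp only); omega) h6
            (try simp only at *)
            omega
          · exact h.row c d hca hda q1 q2 hx
      · intro c d q1 q2
        by_cases hca : c = α <;> by_cases hda : d = α
        · rw [hca, hda] at q1; omega
        · subst hca
          rw [key d hda, Function.update_self]
          have := h.down d q2.symm q1
          show (lo : ℕ) < T d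
          (try simp only at *); omega
        · subst hda
          rw [key c hca, Function.update_self]; exact hU' c q2 q1
        · rw [key c hca, key d hda]
          exact h.col c d hca hda q1 q2
      · intro c hc; rw [key c (by rintro rfl; exact hc h.memW)]; exact h.off c hc
    · rintro ⟨T, α⟩ h
      simp only [Finset.mem_filter, Finset.mem_univ, true_and] at h ⊢
      rw [Function.update_idem, ← h.2.2.2, Function.update_eq_self]
    · rintro ⟨T, α⟩ h
      simp only [Finset.mem_filter, Finset.mem_univ, true_and] at h ⊢
      have := h.1.val
      (try simp only at this)
      rw [Function.update_idem, ← this, Function.update_eq_self]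
    · rintro ⟨T, α⟩ h
      rw [hw]; unfold hwt
      apply Finset.prod_congr rfl
      intro c hc
      (try simp only)
      by_cases hca : c = α
      · simp [hca]
      · rw [Function.update_of_ne hca]
  have split : ∀ (P Q : (ι → Fin n) × ι → Prop), ∑ p with C p, w p =
      ∑ p with (C p ∧ P p), w p + (∑ p with (C p ∧ ¬ P p ∧ Q p), w p + 
        ∑ p with (C p ∧ ¬ P p ∧ ¬ Q p), w p) := by
    intro P Q
    rw [← Finset.sum_filter_add_sum_filter_not (Finset.univ.filter C) P, Finset.filter_filter,
      Finset.filter_filter, ← Finset.sum_filter_add_sum_filter_not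
        (Finset.univ.filter (fun a => C a ∧ ¬ P a)) Q, Finset.filter_filter, Finset.filter_filter]
    simp only [and_assoc]
  have m1 : ∑ p with (C p ∧ D p), w p = ∑ p with (C p ∧ U p), w p := by
    refine Finset.sum_bij'
      (fun p _ => (Function.update p.1 p.2 lo, nb rw cl (rw p.2 + 1) (cl p.2) p.2))
      (fun p _ => (Function.update p.1 (nb rw cl (rw p.2 - 1) (cl p.2) p.2) hi,
        nb rw cl (rw p.2 - 1) (cl p.2) p.2)) ?_ ?_ ?_ ?_ ?_
    · rintro ⟨T, α⟩ h
      simp only [Finset.mem_filter, Finset.mem_univ, true_and] at h ⊢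
      obtain ⟨b, b1, b2, b3⟩ := h.1.nbD G h.2
      (try simp only at b1 b2 b3)
      rw [G.nb_eq b1 b2]
      exact h.1.moveD G hlh hW b1 b2 b3
    · rintro ⟨T, α⟩ h
      simp only [Finset.mem_filter, Finset.mem_univ, true_and] at h ⊢
      obtain ⟨b, b1, b2, b3⟩ := h.1.nbU G h.2
      (try simp only at b1 b2 b3)
      rw [G.nb_eq (e := b) (by omega) b2]
      exact h.1.moveU G hlh (bU T α b h.1 b1 b2 b3) b1 b2 b3
    · rintro ⟨T, α⟩ h
      simp only [Finset.mem_filter, Finset.mem_univ, true_and] at h ⊢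
      obtain ⟨b, b1, b2, b3⟩ := h.1.nbD G h.2
      have hv := h.1.val
      (try simp only at b1 b2 b3 hv)
      rw [G.nb_eq b1 b2, G.nb_eq (e := α) (by omega) (by omega), Function.update_idem, ← hv,
        Function.update_eq_self]
    · rintro ⟨T, α⟩ h
      simp only [Finset.mem_filter, Finset.mem_univ, true_and] at h ⊢
      obtain ⟨b, b1, b2, b3⟩ := h.1.nbU G h.2
      (try simp only at b1 b2 b3)
      rw [G.nb_eq (e := b) (by omega) b2, G.nb_eq (e := α) (by omega) (by omega), Function.update_idem, ← b3,
        Function.update_eq_self]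
    · rintro ⟨T, α⟩ h
      simp only [Finset.mem_filter, Finset.mem_univ, true_and] at h ⊢
      obtain ⟨b, b1, b2, b3⟩ := h.1.nbD G h.2
      (try simp only at b1 b2 b3)
      rw [G.nb_eq b1 b2]
      have hab : α < b := (G.ord _ _).2 (by omega)
      apply hwt_move (α := α) (β := b) u _ T h.1.memW (hW _ _ h.1.memW hab) hab b3
      · omega
      · intro c c1 c2
        rw [G.ord] at c1 c2; omega
  have m2 : ∑ p with (C p ∧ ¬ U p ∧ L p), w p = ∑ p with (C p ∧ ¬ D p ∧ R p), w p := by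
    refine Finset.sum_bij'
      (fun p _ => (Function.update p.1 p.2 lo, nb rw cl (rw p.2) (cl p.2 - 1) p.2))
      (fun p _ => (Function.update p.1 (nb rw cl (rw p.2) (cl p.2 + 1) p.2) hi,
        nb rw cl (rw p.2) (cl p.2 + 1) p.2)) ?_ ?_ ?_ ?_ ?_
    · rintro ⟨T, α⟩ h
      simp only [Finset.mem_filter, Finset.mem_univ, true_and] at h ⊢
      obtain ⟨b, b1, b2, b3⟩ := h.1.nbL G h.2.2
      (try simp only at b1 b2 b3)
      rw [G.nb_eq (e := b) b1 (by omega)]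
      have := h.1.moveL G hlh hW h.2.1 b1 b2 b3
      exact ⟨this.1, this.2.2, this.2.1⟩
    · rintro ⟨T, α⟩ h
      simp only [Finset.mem_filter, Finset.mem_univ, true_and] at h ⊢
      obtain ⟨b, b1, b2, b3⟩ := h.1.nbR G h.2.2
      (try simp only at b1 b2 b3)
      rw [G.nb_eq (e := b) (by omega) b2]
      have := h.1.moveR G hlh h.2.1 (bR T α b h.1 h.2.1 b1 b2 b3) b1 b2 b3
      exact ⟨this.1, this.2.2, this.2.1⟩
    · rintro ⟨T, α⟩ h
      simp only [Finset.mem_filter, Finset.mem_univ, true_and] at h ⊢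
      obtain ⟨b, b1, b2, b3⟩ := h.1.nbL G h.2.2
      have hv := h.1.val
      (try simp only at b1 b2 b3 hv)
      rw [G.nb_eq (e := b) b1 (by omega), G.nb_eq (e := α) (by omega) (by omega), Function.update_idem, ← hv,
        Function.update_eq_self]
    · rintro ⟨T, α⟩ h
      simp only [Finset.mem_filter, Finset.mem_univ, true_and] at h ⊢
      obtain ⟨b, b1, b2, b3⟩ := h.1.nbR G h.2.2
      (try simp only at b1 b2 b3)
      rw [G.nb_eq (e := b) (by omega) b2, G.nb_eq (e := α) (by omega) (by omega), Function.update_idem, ← b3,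
        Function.update_eq_self]
    · rintro ⟨T, α⟩ h
      simp only [Finset.mem_filter, Finset.mem_univ, true_and] at h ⊢
      obtain ⟨b, b1, b2, b3⟩ := h.1.nbL G h.2.2
      (try simp only at b1 b2 b3)
      rw [G.nb_eq (e := b) b1 (by omega)]
      have hab : α < b := (G.ord _ _).2 (by omega)
      have hC : Cfg rw cl W T0 lo hi T α := h.1
      have hnD : ¬ HD rw cl hi T α := fun hh => hC.nLD G h.2.2 hh
      apply hwt_move (α := α) (β := b) u _ T hC.memW (hW _ _ hC.memW hab) hab b3
      · omega
      · intro c c1 c2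
        rw [G.ord] at c1 c2
        by_cases hcc : cl c = cl α
        · have q1 := hC.down c hcc (by (try simp only); omega)
          (try simp only at q1)
          have : T c ≠ hi := fun hh => hnD ⟨c, hcc, by omega, hh⟩
          refine ⟨?_, this⟩
          intro hh; rw [hh] at q1; omega
        · have q1 := hC.col c b (by (try simp only); rintro rfl; omega) (by (try simp only); rintro rfl; omega) (by omega) (by omega)
          (try simp only at q1)
          rw [b3] at q1
          refine ⟨?_, fun hh => by rw [hh] at q1; omega⟩
          intro hh
          obtain ⟨e, e1, e2⟩ := G.conv c α (rw c) (cl α) le_rfl (by omega) (by omega) le_rfl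
          have q2 := hC.row c e (by (try simp only); rintro rfl; omega) (by (try simp only); rintro rfl; omega) e1.symm (by omega) (by (try simp only); omega)
          have q3 := hC.up e e2 (by (try simp only); omega)
          (try simp only at q2 q3)
          rw [hh] at q2
          exact h.2.1 ⟨e, e2, by (try simp only); omega, Fin.ext (by (try simp only); omega)⟩
  rw [sA, sB]
  have e1 := split D R
  have e2 := split U L
  rw [e1, m1, m2] at e2
  exact add_left_cancel (add_left_cancel e2)

open Classical in
theorem bk_symm (G : Geo rw cl) (hlh : (hi : ℕ) = lo + 1) (hW : ∀ c d, c ∈ W → c < d → d ∈ W)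
    (hQ : W = Finset.univ ∨ ∃ α0, W = Finset.univ.filter (α0 < ·) ∧ T0 α0 = hi)
    (u : Fin n → K) (b : ℤ → K) :
    ∑ T : ι → Fin n with Ss rw cl T ∧ (∀ c ∉ W, T c = T0 c), ∏ c ∈ W, fac rw cl u b (T c) c =
    ∑ T : ι → Fin n with Ss rw cl T ∧ (∀ c ∉ W, T c = T0 c),
      ∏ c ∈ W, fac rw cl (u ∘ Equiv.swap lo hi) b (T c) c := by
  rw [← sub_eq_zero, ← Finset.sum_sub_distrib]
  simp only [tele_comm]
  have lohi : lo ≠ hi := by intro h; rw [h] at hlh; omega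
  have hd : ∀ v : Fin n, u v - (u ∘ Equiv.swap lo hi) v =
      (if v = lo then u lo - u hi else 0) - (if v = hi then u lo - u hi else 0) := by
    intro v
    by_cases h1 : v = lo
    · subst h1; simp [lohi]
    · by_cases h2 : v = hi
      · subst h2; simp [lohi.symm]
      · simp [h1, h2, Equiv.swap_apply_of_ne_of_ne h1 h2]
  simp only [hd, sub_mul, Finset.sum_sub_distrib]
  have conv : ∀ v : Fin n, ∑ T : ι → Fin n with Ss rw cl T ∧ (∀ c ∉ W, T c = T0 c),
      ∑ α ∈ W, (if T α = v then u lo - u hi else 0) * hwt rw cl u (u ∘ Equiv.swap lo hi) b W (T, α) =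
      (u lo - u hi) * ∑ p : (ι → Fin n) × ι with Ss rw cl p.1 ∧ (∀ c ∉ W, p.1 c = T0 c) ∧ p.2 ∈ W ∧ p.1 p.2 = v,
      hwt rw cl u (u ∘ Equiv.swap lo hi) b W p := by
    intro v
    rw [Finset.mul_sum, Finset.sum_filter, Finset.sum_filter, Fintype.sum_prod_type]
    apply Finset.sum_congr rfl
    intro T _
    by_cases hT : Ss rw cl T ∧ (∀ c ∉ W, T c = T0 c)
    · rw [if_pos hT, ← Finset.sum_subset (Finset.subset_univ W)]
      · apply Finset.sum_congr rfl
        intro α hα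
        by_cases hv : T α = v
        · simp [hT.1, hα, hv]
          intro x hx hx2; exact absurd (hT.2 x hx) hx2
        · simp [hv]
      · intro α _ hα
        simp [hα]
    · rw [if_neg hT]
      symm; apply Finset.sum_eq_zero
      intro α _
      rw [if_neg]
      rintro ⟨h1, h2, -⟩; exact hT ⟨h1, h2⟩
  rw [conv, conv, sum_cfg G hlh hW hQ, sub_self]

end BK2

section Oprod
variable {ι : Type} [LinearOrder ι] {A : Type} [CommRing A]
variable {M N : Type} [AddCommGroup M] [AddCommGroup N] [Module A M] [Module A N]

/-- ordered product of operators -/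
def oprod (f : ι → Module.End A M) (S : Finset ι) : Module.End A M :=
  ((S.sort (· ≤ ·)).map f).prod

theorem oprod_empty (f : ι → Module.End A M) : oprod f ∅ = 1 := by
  simp [oprod]

theorem oprod_insert (f : ι → Module.End A M) (c : ι) (S : Finset ι) (h : ∀ d ∈ S, c < d) :
    oprod f (insert c S) = f c * oprod f S := by
  unfold oprod
  rw [Finset.sort_insert _ (fun b hb => (h b hb).le) (fun hc => lt_irrefl _ (h c hc))]
  simp

theorem oprod_congr {f g : ι → Module.End A M} {S : Finset ι} (h : ∀ c ∈ S, f c = g c) :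
    oprod f S = oprod g S := by
  unfold oprod
  congr 1
  apply List.map_congr_left
  intro c hc
  exact h c (by simpa using hc)

theorem tele (Y : ι → Module.End A M) (x : ι → Module.End A N) (R : N → M) (h : N) (S : Finset ι) :
    oprod Y S (R h) - R (oprod x S h) =
    ∑ α ∈ S, oprod Y (S.filter (· < α)) (Y α (R (oprod x (S.filter (α < ·)) h)) -
      R (x α (oprod x (S.filter (α < ·)) h))) := by
  induction S using Finset.induction_on_min with
  | empty => simp [oprod_empty]
  | insert c S hc ih =>
    have hcS : c ∉ S := fun h => lt_irrefl _ (hc c h)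
    rw [oprod_insert _ _ _ hc, oprod_insert _ _ _ hc, Finset.sum_insert hcS]
    have e1 : (insert c S).filter (· < c) = ∅ := by
      ext d; simp only [Finset.mem_filter, Finset.mem_insert, Finset.notMem_empty, iff_false]
      rintro ⟨rfl | h, h2⟩
      · exact lt_irrefl _ h2
      · exact lt_asymm (hc d h) h2
    have e2 : (insert c S).filter (c < ·) = S := by
      ext d; simp only [Finset.mem_filter, Finset.mem_insert]
      constructor
      · rintro ⟨rfl | h, h2⟩
        · exact absurd h2 (lt_irrefl _)
        · exact h
      · intro h; exact ⟨Or.inr h, hc d h⟩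
    rw [e1, e2, oprod_empty]
    have e3 : ∀ α ∈ S, (insert c S).filter (· < α) = insert c (S.filter (· < α)) := by
      intro α hα; rw [Finset.filter_insert, if_pos (hc α hα)]
    have e4 : ∀ α ∈ S, (insert c S).filter (α < ·) = S.filter (α < ·) := by
      intro α hα; rw [Finset.filter_insert, if_neg (hc α hα).not_gt]
    have : ∑ α ∈ S, oprod Y ((insert c S).filter (· < α)) (Y α (R (oprod x ((insert c S).filter (α < ·)) h)) -
      R (x α (oprod x ((insert c S).filter (α < ·)) h))) = Y c (oprod Y S (R h) - R (oprod x S h)) := by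
      rw [ih, map_sum]
      apply Finset.sum_congr rfl
      intro α hα
      rw [e3 α hα, e4 α hα, oprod_insert _ _ _ (fun d hd => hc d (Finset.mem_filter.1 hd).1)]
      rfl
    rw [this]
    simp only [Module.End.mul_apply, Module.End.one_apply, map_sub]
    abel

end Oprod

section Psi
variable {A : Type} [CommRing A]

theorem exists_aeval {σ B : Type} [Ring B] [Algebra A B] (x : σ → B)
    (hx : ∀ i j, x i * x j = x j * x i) :
    ∃ Ψ : MvPolynomial σ A →ₐ[A] B, ∀ r, Ψ (MvPolynomial.X r) = x r := by
  have : IsMulCommutative (Algebra.adjoin A (Set.range x)) := by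
    apply Algebra.isMulCommutative_adjoin
    rintro _ ⟨i, rfl⟩ _ ⟨j, rfl⟩; exact hx i j
  letI : CommRing (Algebra.adjoin A (Set.range x)) :=
    { (inferInstance : Ring (Algebra.adjoin A (Set.range x))) with mul_comm := this.is_comm.comm }
  let g : σ → Algebra.adjoin A (Set.range x) := fun i => ⟨x i, Algebra.subset_adjoin ⟨i, rfl⟩⟩
  refine ⟨(Algebra.adjoin A (Set.range x)).val.comp (MvPolynomial.aeval g), ?_⟩
  intro r
  simp [g]

variable {n : ℕ}

/-- the operators on functions of positions -/
def xop (a : ℤ → A) (r : Fin n) : Module.End A ((Fin n → ℤ) → A) where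
  toFun h p := a (p r) * h p + h (p + Pi.single r 1)
  map_add' h g := by ext p; simp; ring
  map_smul' t h := by ext p; simp; ring

theorem xop_apply (a : ℤ → A) (r : Fin n) (h : (Fin n → ℤ) → A) (p : Fin n → ℤ) :
    xop a r h p = a (p r) * h p + h (p + Pi.single r 1) := rfl

theorem xop_comm (a : ℤ → A) (r s : Fin n) : xop a r * xop a s = xop a s * xop a r := by
  by_cases hrs : r = s
  · rw [hrs]
  · ext h p
    simp only [LinearMap.comp_apply, Module.End.mul_apply, xop_apply, Pi.add_apply,
      Pi.single_eq_of_ne hrs, Pi.single_eq_of_ne (Ne.symm hrs), add_zero]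
    rw [add_right_comm p]
    ring

/-- antisymmetric under one permutation -/
def ASw (s : Equiv.Perm (Fin n)) (h : (Fin n → ℤ) → A) : Prop := ∀ p : Fin n → ℤ, h (p ∘ s) = - h p

theorem psi_swap (a : ℤ → A) (Ψ : MvPolynomial (Fin n) A →ₐ[A] Module.End A ((Fin n → ℤ) → A))
    (hΨ : ∀ r, Ψ (MvPolynomial.X r) = xop a r) (s : Equiv.Perm (Fin n))
    (F : MvPolynomial (Fin n) A) : ∀ (h : (Fin n → ℤ) → A) (p : Fin n → ℤ),
    Ψ F h (p ∘ s) = Ψ (MvPolynomial.rename s F) (fun q => h (q ∘ s)) p := by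
  induction F using MvPolynomial.induction_on with
  | C t =>
    intro h p
    have : ∀ t : A, (MvPolynomial.C t : MvPolynomial (Fin n) A) = algebraMap _ _ t := fun _ => rfl
    rw [MvPolynomial.rename_C, this, AlgHom.commutes]
    rfl
  | add F G hF hG => intro h p; simp only [map_add, LinearMap.add_apply, Pi.add_apply, hF, hG]
  | mul_X F r hF =>
    intro h p
    simp only [map_mul, MvPolynomial.rename_X, hΨ, Module.End.mul_apply, hF]
    have key : (fun q : Fin n → ℤ => xop a r h (q ∘ s)) = xop a (s r) (fun q => h (q ∘ s)) := by
      ext q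
      simp only [xop_apply]
      congr 2
      ext i
      simp only [Pi.add_apply, Function.comp, Pi.single_apply]
      congr 1
      simp only [s.injective.eq_iff]
    rw [key]

theorem ASw_psi (a : ℤ → A) (Ψ : MvPolynomial (Fin n) A →ₐ[A] Module.End A ((Fin n → ℤ) → A))
    (hΨ : ∀ r, Ψ (MvPolynomial.X r) = xop a r) (s : Equiv.Perm (Fin n))
    (F : MvPolynomial (Fin n) A) (hF : MvPolynomial.rename s F = F) (h : (Fin n → ℤ) → A)
    (hh : ASw s h) : ASw s (Ψ F h) := by
  intro p
  rw [psi_swap a Ψ hΨ s, hF]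
  have : (fun q : Fin n → ℤ => h (q ∘ s)) = - h := by ext q; exact hh q
  rw [this, map_neg]; rfl

/-- alternating indicator -/
noncomputable def fdet (A : Type) [CommRing A] (q : Fin n → ℤ) (p : Fin n → ℤ) : A :=
  (Matrix.of fun i j => if p i = q j then (1 : A) else 0).det

theorem fdet_ASw (q : Fin n → ℤ) (i j : Fin n) (hij : i ≠ j) :
    ASw (Equiv.swap i j) (fdet A q) := by
  intro p
  unfold fdet
  have := Matrix.det_permute (Equiv.swap i j) (Matrix.of fun i j => if p i = q j then (1 : A) else 0)
  rw [Equiv.Perm.sign_swap hij] at this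
  simp only [Units.val_neg, Units.val_one, Int.cast_neg, Int.cast_one, neg_mul, one_mul] at this
  rw [← this]; rfl

theorem fdet_eq (q p : Fin n → ℤ) (hq : StrictAnti q) (hp : StrictAnti p) :
    fdet A q p = if p = q then 1 else 0 := by
  split_ifs with h
  · subst h
    unfold fdet
    rw [← Matrix.det_one (n := Fin n)]
    congr 1
    ext i j
    simp [Matrix.one_apply, hp.injective.eq_iff]
  · by_contra hd
    apply h
    have h1 : ∀ i, ∃ j, p i = q j := by
      intro i; by_contra hc; push Not at hc
      exact hd (Matrix.det_eq_zero_of_row_eq_zero i (by intro j; simp [hc j]))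
    have h2 : ∀ j, ∃ i, p i = q j := by
      intro i; by_contra hc; push Not at hc
      exact hd (Matrix.det_eq_zero_of_column_eq_zero i (by intro j; simp [hc j]))
    have h3 : Set.range p = Set.range q := by
      ext z; constructor
      · rintro ⟨i, rfl⟩; obtain ⟨j, hj⟩ := h1 i; exact ⟨j, hj.symm⟩
      · rintro ⟨i, rfl⟩; exact h2 i
    have h4 : (fun i => - p i) = (fun i => - q i) := by
      refine (StrictMono.range_inj (fun i j hij => neg_lt_neg (hp hij)) (fun i j hij => neg_lt_neg (hq hij))).1 ?_
      have := congrArg (fun s => Neg.neg '' s) h3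
      simpa [← Set.range_comp, Function.comp_def] using this
    ext i; have := congrFun h4 i; simpa using this

end Psi

/-- row `r` can receive a box -/
def Addable (ρ : YoungDiagram) (r : ℕ) : Prop := r = 0 ∨ ρ.rowLen r < ρ.rowLen (r - 1)

open Classical in
/-- add a box in row `r` -/
noncomputable def addBox (ρ : YoungDiagram) (r : ℕ) : YoungDiagram :=
  if h : Addable ρ r then
    { cells := insert (r, ρ.rowLen r) ρ.cells
      isLowerSet := by
        rintro ⟨i, j⟩ ⟨i', j'⟩ hle hm
        simp only [Finset.coe_insert, Set.mem_insert_iff, Finset.mem_coe, YoungDiagram.mem_cells,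
          Prod.mk.injEq, YoungDiagram.mem_iff_lt_rowLen] at hm ⊢
        obtain ⟨h1, h2⟩ := Prod.mk_le_mk.1 hle
        rcases hm with ⟨rfl, rfl⟩ | hm
        · by_cases hi : i' = i
          · subst hi; omega
          · right
            rcases h with h | h
            · omega
            · have := ρ.rowLen_anti i' (i - 1) (by omega)
              omega
        · right
          have := ρ.rowLen_anti i' i h1
          omega }
  else ρ

theorem mem_addBox {ρ : YoungDiagram} {r : ℕ} (h : Addable ρ r) (c : ℕ × ℕ) :
    c ∈ addBox ρ r ↔ c = (r, ρ.rowLen r) ∨ c ∈ ρ := by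
  unfold addBox
  rw [dif_pos h, ← YoungDiagram.mem_cells]
  simp

theorem cells_addBox {ρ : YoungDiagram} {r : ℕ} (h : Addable ρ r) :
    (addBox ρ r).cells = insert (r, ρ.rowLen r) ρ.cells := by
  ext c
  rw [YoungDiagram.mem_cells, mem_addBox h]; simp

theorem notMem_corner (ρ : YoungDiagram) (r : ℕ) : (r, ρ.rowLen r) ∉ ρ.cells := by
  rw [YoungDiagram.mem_cells, YoungDiagram.mem_iff_lt_rowLen]; omega

theorem card_addBox {ρ : YoungDiagram} {r : ℕ} (h : Addable ρ r) :
    (addBox ρ r).card = ρ.card + 1 := by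
  unfold YoungDiagram.card
  rw [cells_addBox h, Finset.card_insert_of_notMem (notMem_corner ρ r)]

theorem rowLen_ext {ρ : YoungDiagram} {i k : ℕ} (h : ∀ j, (i, j) ∈ ρ ↔ j < k) : ρ.rowLen i = k := by
  have h1 := h (ρ.rowLen i)
  have h2 := h k
  rw [YoungDiagram.mem_iff_lt_rowLen] at h1 h2
  omega

theorem rowLen_addBox {ρ : YoungDiagram} {r : ℕ} (h : Addable ρ r) (i : ℕ) :
    (addBox ρ r).rowLen i = ρ.rowLen i + if i = r then 1 else 0 := by
  apply rowLen_ext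
  intro j
  rw [mem_addBox h, YoungDiagram.mem_iff_lt_rowLen, Prod.mk.injEq]
  split_ifs with hi
  · subst hi; omega
  · omega

theorem yd_ext {ρ σ : YoungDiagram} (h : ∀ i, ρ.rowLen i = σ.rowLen i) : ρ = σ := by
  ext ⟨i, j⟩
  rw [YoungDiagram.mem_cells, YoungDiagram.mem_cells, YoungDiagram.mem_iff_lt_rowLen,
    YoungDiagram.mem_iff_lt_rowLen, h]

theorem covers_addBox {ρ : YoungDiagram} {r : ℕ} (h : Addable ρ r) : Covers ρ (addBox ρ r) := by
  refine ⟨?_, card_addBox h⟩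
  intro c hc
  exact (mem_addBox h c).2 (Or.inr hc)

theorem stepRow_addBox {ρ : YoungDiagram} {r : ℕ} (h : Addable ρ r) : stepRow ρ (addBox ρ r) = r := by
  unfold stepRow
  have : (addBox ρ r).cells \ ρ.cells = {(r, ρ.rowLen r)} := by
    rw [cells_addBox h, Finset.insert_sdiff_of_notMem _ (notMem_corner ρ r), Finset.sdiff_self]
    rfl
  rw [this]; simp

theorem exists_addBox {ρ σ : YoungDiagram} (h : Covers ρ σ) : ∃ r, Addable ρ r ∧ σ = addBox ρ r := by
  obtain ⟨h1, h2⟩ := h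
  have hsub : ρ.cells ⊆ σ.cells := h1
  have h3 : (σ.cells \ ρ.cells).card = 1 := by
    rw [Finset.card_sdiff_of_subset hsub]
    unfold YoungDiagram.card at h2; omega
  obtain ⟨⟨r, j⟩, hc⟩ := Finset.card_eq_one.1 h3
  have hmem : ∀ c, c ∈ σ ∧ c ∉ ρ ↔ c = (r, j) := by
    intro c
    have : c ∈ σ.cells \ ρ.cells ↔ c ∈ ({(r, j)} : Finset (ℕ × ℕ)) := by rw [hc]
    simpa using this
  have hm := (hmem (r, j)).2 rfl
  have hj : j = ρ.rowLen r := by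
    have h4 : ¬ j < ρ.rowLen r := by rw [← YoungDiagram.mem_iff_lt_rowLen]; exact hm.2
    by_contra hne
    have h5 : (r, ρ.rowLen r) ∈ σ := by
      have := hm.1
      rw [YoungDiagram.mem_iff_lt_rowLen] at this ⊢; omega
    have := (hmem (r, ρ.rowLen r)).1 ⟨h5, by rw [YoungDiagram.mem_iff_lt_rowLen]; omega⟩
    rw [Prod.mk.injEq] at this; omega
  have hadd : Addable ρ r := by
    by_contra hn
    unfold Addable at hn
    push Not at hn
    have h5 : (r - 1, j) ∈ σ := by
      have h6 := hm.1
      have := σ.rowLen_anti (r - 1) r (by omega)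
      rw [YoungDiagram.mem_iff_lt_rowLen] at h6 ⊢; omega
    have := (hmem (r - 1, j)).1 ⟨h5, by rw [YoungDiagram.mem_iff_lt_rowLen]; omega⟩
    rw [Prod.mk.injEq] at this; omega
  refine ⟨r, hadd, ?_⟩
  ext c
  rw [cells_addBox hadd, Finset.mem_insert, ← hj, ← hmem, YoungDiagram.mem_cells, YoungDiagram.mem_cells]
  constructor
  · intro h; by_cases hh : c ∈ ρ
    · exact Or.inr hh
    · exact Or.inl ⟨h, hh⟩
  · rintro (h | h)
    · exact h.1
    · exact h1 h

theorem addBox_inj {ρ : YoungDiagram} {r r' : ℕ} (h : Addable ρ r) (h' : Addable ρ r')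
    (e : addBox ρ r = addBox ρ r') : r = r' := by
  rw [← stepRow_addBox h, e, stepRow_addBox h']

theorem colLen_le_iff (ρ : YoungDiagram) (n : ℕ) : ρ.colLen 0 ≤ n ↔ ρ.rowLen n = 0 := by
  have h1 : (n, 0) ∈ ρ ↔ _ := YoungDiagram.mem_iff_lt_rowLen
  have h2 : (n, 0) ∈ ρ ↔ _ := YoungDiagram.mem_iff_lt_colLen
  rw [h1] at h2; omega

theorem colLen_addBox {ρ : YoungDiagram} {r n : ℕ} (h : Addable ρ r) (hr : r < n) :
    ρ.colLen 0 ≤ n → (addBox ρ r).colLen 0 ≤ n := by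
  rw [colLen_le_iff, colLen_le_iff, rowLen_addBox h, if_neg (by omega)]
  exact id

section Ops
variable {A : Type} [CommRing A] {n : ℕ}

/-- positions -/
def pos (n : ℕ) (ρ : YoungDiagram) : Fin n → ℤ := fun i => (ρ.rowLen i : ℤ) + (n : ℤ) - (i : ℤ)

theorem pos_strictAnti (ρ : YoungDiagram) : StrictAnti (pos n ρ) := by
  intro i j hij
  have : (i : ℕ) < j := hij
  have := ρ.rowLen_anti i j (by omega)
  unfold pos; omega

theorem pos_inj {ρ σ : YoungDiagram} (h1 : ρ.colLen 0 ≤ n) (h2 : σ.colLen 0 ≤ n) (h : pos n ρ = pos n σ) :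
    ρ = σ := by
  apply yd_ext
  intro i
  by_cases hi : i < n
  · have := congrFun h ⟨i, hi⟩
    simp only [pos] at this; omega
  · rw [colLen_le_iff] at h1 h2
    have := ρ.rowLen_anti n i (by omega)
    have := σ.rowLen_anti n i (by omega)
    omega

theorem pos_addBox {ρ : YoungDiagram} {r : Fin n} (h : Addable ρ r) :
    pos n (addBox ρ r) = pos n ρ + Pi.single r 1 := by
  ext i
  simp only [pos, rowLen_addBox h, Pi.add_apply, Pi.single_apply, Fin.ext_iff]
  push_cast
  split_ifs <;> omega

/-- multiplication operator -/
def Xop (a : ℤ → A) (r : Fin n) : Module.End A (YoungDiagram → A) where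
  toFun g ρ := a (pos n ρ r) * g ρ
  map_add' h g := by ext p; simp; ring
  map_smul' t h := by ext p; simp; ring

open Classical in
/-- box adding operator -/
noncomputable def Eop (A : Type) [CommRing A] (r : ℕ) : Module.End A (YoungDiagram → A) where
  toFun g ρ := if Addable ρ r then g (addBox ρ r) else 0
  map_add' h g := by ext p; simp only [Pi.add_apply]; split_ifs <;> simp
  map_smul' t h := by ext p; simp

theorem Xop_apply (a : ℤ → A) (r : Fin n) (g : YoungDiagram → A) (ρ : YoungDiagram) :
    Xop a r g ρ = a (pos n ρ r) * g ρ := rfl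

open Classical in
theorem Eop_apply (r : ℕ) (g : YoungDiagram → A) (ρ : YoungDiagram) :
    Eop A r g ρ = if Addable ρ r then g (addBox ρ r) else 0 := rfl

/-- cell operator -/
noncomputable def Yop (a : ℤ → A) (r : Fin n) (β : A) : Module.End A (YoungDiagram → A) :=
  Xop a r + Eop A r - algebraMap A _ β

noncomputable def Eall (A : Type) [CommRing A] (n : ℕ) : Module.End A (YoungDiagram → A) :=
  ∑ r : Fin n, Eop A (r : ℕ)

noncomputable def Zop (n : ℕ) (a : ℤ → A) : Module.End A (YoungDiagram → A) :=
  ∑ r : Fin n, (Xop a r + Eop A r)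

theorem Xop_comm (a : ℤ → A) (r s : Fin n) : Xop a r * Xop a s = Xop a s * Xop a r := by
  ext g ρ
  simp only [Module.End.mul_apply, Xop_apply]; ring

theorem Xop_Eop (a : ℤ → A) (r s : Fin n) (h : r ≠ s) : Xop a r * Eop A s = Eop A s * Xop a r := by
  ext g ρ
  simp only [Module.End.mul_apply, Xop_apply, Eop_apply]
  split_ifs with hh
  · rw [pos_addBox hh, Pi.add_apply, Pi.single_eq_of_ne h, add_zero]
  · simp

theorem Z_Y (a : ℤ → A) (r : Fin n) (β : A) :
    Yop a r β * Zop n a - Zop n a * Yop a r β = Eop A r * Eall A n - Eall A n * Eop A r := by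
  have e1 : ∀ s : Fin n, Xop a r * Eop A s + Eop A r * Xop a s - (Xop a s * Eop A r + Eop A s * Xop a r)
      = 0 := by
    intro s
    by_cases h : r = s
    · subst h; abel
    · rw [Xop_Eop a r s h, Xop_Eop a s r (Ne.symm h)]; abel
  have e2 : Yop a r β * Zop n a - Zop n a * Yop a r β =
      (Xop a r + Eop A r) * Zop n a - Zop n a * (Xop a r + Eop A r) := by
    unfold Yop
    rw [sub_mul, mul_sub, Algebra.commutes]; abel
  rw [e2]
  unfold Zop Eall
  rw [← sub_eq_zero, Finset.mul_sum, Finset.sum_mul, Finset.mul_sum, Finset.sum_mul,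
    ← Finset.sum_sub_distrib, ← Finset.sum_sub_distrib, ← Finset.sum_sub_distrib]
  apply Finset.sum_eq_zero
  intro s _
  rw [← e1 s, mul_add, add_mul, add_mul, mul_add, add_mul, add_mul, Xop_comm a r s]
  abel

/-- restriction to partitions -/
def res (h : (Fin n → ℤ) → A) : YoungDiagram → A := fun ρ => h (pos n ρ)

theorem res_fdet {ν ρ : YoungDiagram} (h1 : ν.colLen 0 ≤ n) (h2 : ρ.colLen 0 ≤ n) [Decidable (ρ = ν)] :
    res (fdet A (pos n ν)) ρ = if ρ = ν then 1 else 0 := by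
  unfold res
  rw [fdet_eq _ _ (pos_strictAnti ν) (pos_strictAnti ρ)]
  by_cases h : ρ = ν
  · subst h; simp
  · rw [if_neg h, if_neg (fun hh => h (pos_inj h2 h1 hh))]

/-- adjacent antisymmetric -/
def AS (h : (Fin n → ℤ) → A) : Prop :=
  ∀ lo hi : Fin n, (hi : ℕ) = lo + 1 → ASw (Equiv.swap lo hi) h

theorem Y_res [IsDomain A] [CharZero A] (a : ℤ → A) (r : Fin n) (h : (Fin n → ℤ) → A)
    (hh : ∀ lo : Fin n, (r : ℕ) = lo + 1 → ASw (Equiv.swap lo r) h) :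
    (Xop a r + Eop A r) (res h) = res (xop a r h) := by
  ext ρ
  simp only [LinearMap.add_apply, Pi.add_apply, Xop_apply, Eop_apply, res, xop_apply]
  congr 1
  split_ifs with hA
  · rw [pos_addBox hA]
  · have hA' := hA
    unfold Addable at hA'
    push Not at hA'
    have hlo : (r : ℕ) - 1 < n := by omega
    set lo : Fin n := ⟨(r : ℕ) - 1, hlo⟩ with hlod
    have hr : (r : ℕ) = lo + 1 := by simp only [hlod]; omega
    have := hh lo hr (pos n ρ + Pi.single r 1)
    have e : (pos n ρ + Pi.single r 1) ∘ Equiv.swap lo r = pos n ρ + Pi.single r 1 := by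
      have hlr : lo ≠ r := by intro h; rw [← h] at hr; omega
      have key : (pos n ρ + Pi.single r 1 : Fin n → ℤ) lo = (pos n ρ + Pi.single r 1 : Fin n → ℤ) r := by
        have := ρ.rowLen_anti (r - 1) r (by omega)
        simp only [Pi.add_apply, Pi.single_eq_same, Pi.single_eq_of_ne hlr, pos]
        have : ρ.rowLen lo = ρ.rowLen r := by simp only [hlod]; omega
        omega
      ext i
      simp only [Function.comp]
      by_cases h1 : i = lo
      · subst h1; rw [Equiv.swap_apply_left, key]
      · by_cases h2 : i = r
        · subst h2; rw [Equiv.swap_apply_right, key]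
        · rw [Equiv.swap_apply_of_ne_of_ne h1 h2]
    rw [e] at this
    symm
    exact self_eq_neg.1 this

end Ops

section KT
variable {ι : Type} [LinearOrder ι] {rw cl : ι → ℕ}
variable {A : Type} [CommRing A] {n : ℕ}

theorem oprod_psi {σ M : Type} [AddCommGroup M] [Module A M]
    (Ψ : MvPolynomial σ A →ₐ[A] Module.End A M) (g : ι → MvPolynomial σ A) (S : Finset ι) :
    oprod (fun c => Ψ (g c)) S = Ψ (∏ c ∈ S, g c) := by
  induction S using Finset.induction_on_min with
  | empty => simp [oprod_empty]
  | insert c S hc ih =>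
    have hcS : c ∉ S := fun h => lt_irrefl _ (hc c h)
    rw [oprod_insert _ _ _ hc, Finset.prod_insert hcS, map_mul, ih]

/-- cell operator for a tableau -/
noncomputable def Yc (rw cl : ι → ℕ) (a b : ℤ → A) (T : ι → Fin n) (c : ι) : Module.End A (YoungDiagram → A) :=
  Yop a (T c) (b ((T c : ℤ) + 1 + (cl c : ℤ) - (rw c : ℤ)))

/-- defect -/
def resL : ((Fin n → ℤ) → A) →ₗ[A] (YoungDiagram → A) where
  toFun := res
  map_add' h g := by ext p; rfl
  map_smul' t h := by ext p; rfl

theorem res_sum {κ : Type} (s : Finset κ) (f : κ → (Fin n → ℤ) → A) :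
    res (∑ i ∈ s, f i) = ∑ i ∈ s, res (f i) := map_sum resL f s

noncomputable def Dd (a : ℤ → A) (r : Fin n) : ((Fin n → ℤ) → A) →ₗ[A] (YoungDiagram → A) :=
  (Xop a r + Eop A r).comp resL - resL.comp (xop a r)

/-- cell polynomial -/
noncomputable def pf (rw cl : ι → ℕ) (b : ℤ → A) (T : ι → Fin n) (c : ι) : MvPolynomial (Fin n) A :=
  fac rw cl MvPolynomial.X (fun z => MvPolynomial.C (b z)) (T c) c

theorem rename_pf (b : ℤ → A) (T : ι → Fin n) (c : ι) (s : Equiv.Perm (Fin n)) :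
    MvPolynomial.rename s (pf rw cl b T c) =
      fac rw cl (MvPolynomial.X ∘ s) (fun z => MvPolynomial.C (b z)) (T c) c := by
  simp [pf, fac]

variable (a b : ℤ → A) (Ψ : MvPolynomial (Fin n) A →ₐ[A] Module.End A ((Fin n → ℤ) → A))

theorem Y_sub_x (hΨ : ∀ r, Ψ (MvPolynomial.X r) = xop a r) (T : ι → Fin n) (c : ι) (w : (Fin n → ℤ) → A) :
    Yc rw cl a b T c (res w) - res (Ψ (pf rw cl b T c) w) = Dd a (T c) w := by
  have hC : ∀ t : A, (MvPolynomial.C t : MvPolynomial (Fin n) A) = algebraMap _ _ t := fun _ => rfl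
  unfold Yc pf fac Yop Dd
  beta_reduce
  rw [map_sub, hΨ, hC, AlgHom.commutes]
  ext ρ
  simp only [LinearMap.sub_apply, LinearMap.comp_apply, Pi.sub_apply, Module.algebraMap_end_apply]
  simp only [res, resL, LinearMap.coe_mk, AddHom.coe_mk, Pi.sub_apply, Pi.smul_apply]
  abel

variable [Fintype ι] [IsDomain A] [CharZero A]

open Classical in
theorem Ktheorem (hΨ : ∀ r, Ψ (MvPolynomial.X r) = xop a r) (G : Geo rw cl) (h : (Fin n → ℤ) → A) (hh : AS h) :
    ∑ T : ι → Fin n with Ss rw cl T, oprod (Yc rw cl a b T) Finset.univ (res h) =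
    res (Ψ (∑ T : ι → Fin n with Ss rw cl T, ∏ c, pf rw cl b T c) h) := by
  have e0 : res (Ψ (∑ T : ι → Fin n with Ss rw cl T, ∏ c, pf rw cl b T c) h) =
      ∑ T : ι → Fin n with Ss rw cl T, res (oprod (fun c => Ψ (pf rw cl b T c)) Finset.univ h) := by
    simp only [oprod_psi]
    rw [map_sum, LinearMap.sum_apply, res_sum]
  rw [e0, ← sub_eq_zero, ← Finset.sum_sub_distrib]
  simp only [tele]
  simp only [Y_sub_x a b Ψ hΨ, oprod_psi]
  rw [Finset.sum_comm]
  apply Finset.sum_eq_zero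
  intro α _
  let R : Setoid (ι → Fin n) :=
    { r := fun T T' => ∀ c, c ≤ α → T c = T' c
      iseqv := ⟨fun T c _ => rfl, fun h c hc => (h c hc).symm, fun h h' c hc => (h c hc).trans (h' c hc)⟩ }
  apply Finset.sum_cancels_of_partition_cancels R
  intro T0 _
  set W : Finset ι := Finset.univ.filter (α < ·) with hWd
  have eq1 : (Finset.univ.filter (fun T : ι → Fin n => Ss rw cl T)).filter (fun T => R T T0) =
      Finset.univ.filter (fun T : ι → Fin n => Ss rw cl T ∧ ∀ c ∉ W, T c = T0 c) := by
    rw [Finset.filter_filter]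
    apply Finset.filter_congr
    intro T _
    apply and_congr_right
    intro _
    change (∀ c, c ≤ α → T c = T0 c) ↔ _
    simp [hWd]
  rw [eq1]
  have eq2 : ∀ T ∈ Finset.univ.filter (fun T : ι → Fin n => Ss rw cl T ∧ ∀ c ∉ W, T c = T0 c),
      oprod (Yc rw cl a b T) (Finset.univ.filter (· < α)) (Dd a (T α) (Ψ (∏ c ∈ W, pf rw cl b T c) h)) =
      oprod (Yc rw cl a b T0) (Finset.univ.filter (· < α)) (Dd a (T0 α) (Ψ (∏ c ∈ W, pf rw cl b T c) h)) := by
    intro T hT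
    simp only [Finset.mem_filter, Finset.mem_univ, true_and] at hT
    rw [hT.2 α (by simp [hWd])]
    congr 1
    apply oprod_congr
    intro c hc
    simp only [Finset.mem_filter, Finset.mem_univ, true_and] at hc
    unfold Yc
    rw [hT.2 c (by simp [hWd, hc.le])]
  rw [Finset.sum_congr rfl eq2, ← map_sum, ← map_sum, ← LinearMap.sum_apply, ← map_sum]
  have : Dd a (T0 α) (Ψ (∑ T : ι → Fin n with Ss rw cl T ∧ ∀ c ∉ W, T c = T0 c, ∏ c ∈ W, pf rw cl b T c) h) = 0 := by
    unfold Dd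
    rw [LinearMap.sub_apply, sub_eq_zero]
    apply Y_res
    intro lo hlo
    apply ASw_psi a Ψ hΨ _ _ _ _ (hh lo _ hlo)
    simp only [map_sum, map_prod, rename_pf]
    unfold pf
    symm
    apply bk_symm G hlo
    · intro c d hc hd
      simp only [hWd, Finset.mem_filter, Finset.mem_univ, true_and] at hc ⊢
      exact hc.trans hd
    · right; exact ⟨α, rfl, rfl⟩
  rw [this, map_zero]

open Classical in
theorem comm_identity (G : Geo rw cl) (h : (Fin n → ℤ) → A) (hh : AS h) :
    ∑ T : ι → Fin n with Ss rw cl T, ∑ α, oprod (Yc rw cl a b T) (Finset.univ.filter (· < α))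
      (Eop A (T α : ℕ) (Eall A n (oprod (Yc rw cl a b T) (Finset.univ.filter (α < ·)) (res h)))) =
    ∑ T : ι → Fin n with Ss rw cl T, ∑ α, oprod (Yc rw cl a b T) (Finset.univ.filter (· < α))
      (Eall A n (Eop A (T α : ℕ) (oprod (Yc rw cl a b T) (Finset.univ.filter (α < ·)) (res h)))) := by
  obtain ⟨Ψ, hΨ⟩ := exists_aeval (A := A) (xop (n := n) a) (xop_comm a)
  have hZ : ∀ g : (Fin n → ℤ) → A, AS g → Zop n a (res g) = res (Ψ (∑ r, MvPolynomial.X r) g) := by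
    intro g hg
    unfold Zop
    rw [map_sum, LinearMap.sum_apply, LinearMap.sum_apply, res_sum]
    apply Finset.sum_congr rfl
    intro r _
    rw [hΨ]
    exact Y_res a r g (fun lo hlo => hg lo r hlo)
  have h1 : AS (Ψ (∑ r, MvPolynomial.X r) h) := by
    intro lo hi hlh
    apply ASw_psi a Ψ hΨ _ _ _ _ (hh lo hi hlh)
    simp only [map_sum, MvPolynomial.rename_X]
    exact Equiv.sum_comp (Equiv.swap lo hi) (fun r => MvPolynomial.X r)
  have h2 : AS (Ψ (∑ T : ι → Fin n with Ss rw cl T, ∏ c, pf rw cl b T c) h) := by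
    intro lo hi hlh
    apply ASw_psi a Ψ hΨ _ _ _ _ (hh lo hi hlh)
    simp only [map_sum, map_prod, rename_pf]
    unfold pf
    symm
    have := bk_symm (K := MvPolynomial (Fin n) A) (T0 := fun _ => lo) (W := Finset.univ) G hlh
      (by intros; simp) (Or.inl rfl) MvPolynomial.X (fun z => MvPolynomial.C (b z))
    simpa using this
  have key : ∑ T : ι → Fin n with Ss rw cl T, (oprod (Yc rw cl a b T) Finset.univ (Zop n a (res h)) -
      Zop n a (oprod (Yc rw cl a b T) Finset.univ (res h))) = 0 := by
    rw [Finset.sum_sub_distrib, ← map_sum, Ktheorem a b Ψ hΨ G h hh, hZ _ h2, hZ _ hh,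
      Ktheorem a b Ψ hΨ G _ h1, sub_eq_zero, ← Module.End.mul_apply, ← Module.End.mul_apply,
      ← map_mul, ← map_mul, mul_comm]
  simp only [tele] at key
  rw [← sub_eq_zero, ← Finset.sum_sub_distrib, ← key]
  apply Finset.sum_congr rfl
  intro T _
  rw [← Finset.sum_sub_distrib]
  apply Finset.sum_congr rfl
  intro α _
  rw [← map_sub]
  congr 1
  have := LinearMap.congr_fun (Z_Y a (T α) (b ((T α : ℤ) + 1 + (cl α : ℤ) - (rw α : ℤ))))
    (oprod (Yc rw cl a b T) (Finset.univ.filter (α < ·)) (res h))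
  simp only [LinearMap.sub_apply, Module.End.mul_apply] at this
  rw [← this]
  rfl

end KT

section Chains
variable {A : Type} [CommRing A] {n : ℕ}

open Classical in
/-- chains with `l` steps from the given diagram to `ν` -/
noncomputable def chainF (n : ℕ) (ν : YoungDiagram) : ℕ → YoungDiagram → Finset (List YoungDiagram)
  | 0, μ => if μ = ν then {[μ]} else ∅
  | l + 1, μ => (Finset.univ.filter (fun r : Fin n => Addable μ r)).biUnion
      (fun r => (chainF n ν l (addBox μ r)).image (fun L => μ :: L))

/-- sum over chains -/
noncomputable def CSf (n : ℕ) (ν : YoungDiagram) (l : ℕ) (F : List YoungDiagram → A) (ρ : YoungDiagram) : A :=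
  ∑ L ∈ chainF n ν l ρ, F L

theorem chainF_head {ν : YoungDiagram} {l : ℕ} {ρ : YoungDiagram} {L : List YoungDiagram}
    (h : L ∈ chainF n ν l ρ) : ∃ L', L = ρ :: L' := by
  cases l with
  | zero =>
    unfold chainF at h
    split_ifs at h
    · simp only [Finset.mem_singleton] at h; exact ⟨[], h⟩
    · simp at h
  | succ l =>
    unfold chainF at h
    simp only [Finset.mem_biUnion, Finset.mem_image] at h
    obtain ⟨r, -, L', -, h⟩ := h
    exact ⟨L', h.symm⟩

theorem chainF_length {ν : YoungDiagram} {l : ℕ} {ρ : YoungDiagram} {L : List YoungDiagram}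
    (h : L ∈ chainF n ν l ρ) : L.length = l + 1 := by
  induction l generalizing ρ L with
  | zero =>
    unfold chainF at h
    split_ifs at h
    · simp only [Finset.mem_singleton] at h; rw [h]; rfl
    · simp at h
  | succ l ih =>
    unfold chainF at h
    simp only [Finset.mem_biUnion, Finset.mem_image] at h
    obtain ⟨r, -, L', h1, rfl⟩ := h
    rw [List.length_cons, ih h1]

open Classical in
theorem CSf_succ (ν : YoungDiagram) (l : ℕ) (F : List YoungDiagram → A) (ρ : YoungDiagram) :
    CSf n ν (l + 1) F ρ =
    ∑ r : Fin n, if Addable ρ r then CSf n ν l (fun L => F (ρ :: L)) (addBox ρ r) else 0 := by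
  unfold CSf
  rw [chainF, Finset.sum_biUnion, Finset.sum_filter]
  · apply Finset.sum_congr rfl
    intro r _
    split_ifs with h
    · rw [Finset.sum_image]
      intro L _ L' _ h; simpa using h
    · rfl
  · intro r hr r' hr' hne
    simp only [Finset.coe_filter, Finset.mem_univ, true_and, Set.mem_setOf_eq] at hr hr'
    rw [Function.onFun, Finset.disjoint_left]
    intro L h1 h2
    simp only [Finset.mem_image] at h1 h2
    obtain ⟨L1, h1, rfl⟩ := h1
    obtain ⟨L2, h2, h3⟩ := h2
    obtain ⟨M1, rfl⟩ := chainF_head h1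
    obtain ⟨M2, rfl⟩ := chainF_head h2
    simp only [List.cons.injEq, true_and] at h3
    exact hne (Fin.ext (addBox_inj hr hr' h3.1.symm))

theorem CSf_congr {ν : YoungDiagram} {l : ℕ} {F F' : List YoungDiagram → A} {ρ : YoungDiagram}
    (h : ∀ L', ρ :: L' ∈ chainF n ν l ρ → F (ρ :: L') = F' (ρ :: L')) : CSf n ν l F ρ = CSf n ν l F' ρ := by
  apply Finset.sum_congr rfl
  intro L hL
  obtain ⟨L', rfl⟩ := chainF_head hL
  exact h L' hL

theorem chain_mem {ν : YoungDiagram} (hν : ν.colLen 0 ≤ n) (L : List YoungDiagram) : ∀ μ : YoungDiagram,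
    (μ :: L).IsChain Covers → (μ :: L).getLast? = some ν →
    (μ :: L) ∈ chainF n ν L.length μ ∧ μ ≤ ν ∧ μ.card + L.length = ν.card := by
  induction L with
  | nil =>
    intro μ _ h
    simp at h
    subst h
    simp [chainF]
  | cons σ L ih =>
    intro μ h1 h2
    rw [List.isChain_cons_cons] at h1
    rw [List.getLast?_cons_cons] at h2
    obtain ⟨i1, i2, i3⟩ := ih σ h1.2 h2
    obtain ⟨r, hr, rfl⟩ := exists_addBox h1.1
    have hrn : r < n := by
      have : (r, μ.rowLen r) ∈ ν := i2 ((mem_addBox hr _).2 (Or.inl rfl))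
      rw [YoungDiagram.mem_iff_lt_colLen] at this
      have := ν.colLen_anti 0 (μ.rowLen r) (Nat.zero_le _)
      omega
    refine ⟨?_, h1.1.1.trans i2, ?_⟩
    · rw [List.length_cons, chainF]
      simp only [Finset.mem_biUnion, Finset.mem_image, Finset.mem_filter, Finset.mem_univ, true_and]
      exact ⟨⟨r, hrn⟩, hr, _, i1, rfl⟩
    · rw [card_addBox hr] at i3; rw [List.length_cons]; omega

theorem mem_chain {ν : YoungDiagram} {l : ℕ} : ∀ {μ : YoungDiagram} {L : List YoungDiagram},
    L ∈ chainF n ν l μ → L.IsChain Covers ∧ L.head? = some μ ∧ L.getLast? = some ν := by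
  induction l with
  | zero =>
    intro μ L h
    unfold chainF at h
    split_ifs at h with hh
    · simp only [Finset.mem_singleton] at h; subst h; subst hh; simp
    · simp at h
  | succ l ih =>
    intro μ L h
    unfold chainF at h
    simp only [Finset.mem_biUnion, Finset.mem_image, Finset.mem_filter, Finset.mem_univ, true_and] at h
    obtain ⟨r, hr, L', h1, rfl⟩ := h
    obtain ⟨i1, i2, i3⟩ := ih h1
    obtain ⟨L'', rfl⟩ := chainF_head h1
    refine ⟨List.isChain_cons_cons.2 ⟨covers_addBox hr, i1⟩, rfl, ?_⟩
    rw [List.getLast?_cons_cons]; exact i3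

theorem chainSet_eq {μ ν : YoungDiagram} (hν : ν.colLen 0 ≤ n) :
    chainSet μ ν = ↑(chainF n ν (ν.card - μ.card) μ) := by
  ext L
  rw [Finset.mem_coe]
  constructor
  · rintro ⟨h1, h2, h3⟩
    cases L with
    | nil => simp at h2
    | cons σ L =>
      simp only [List.head?_cons, Option.some.injEq] at h2
      subst h2
      obtain ⟨i1, i2, i3⟩ := chain_mem hν L σ h1 h3
      rw [← i3, Nat.add_sub_cancel_left]; exact i1
  · intro h
    exact mem_chain h

end Chains

section Bars
variable {ι : Type} [LinearOrder ι] {A : Type} [CommRing A]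

/-- sum over sets of barred cells -/
noncomputable def BS (t : ι → ℕ) (wt : ι → YoungDiagram → A) (S : Finset ι) (M : ℕ → YoungDiagram)
    (lab : ℕ → ℕ) (m : ℕ) : A :=
  ∑ B ∈ S.powersetCard m, ∏ c ∈ S, if c ∈ B then (if t c = lab (B.filter (· < c)).card then 1 else 0)
    else wt c (M (B.filter (· < c)).card)

variable (t : ι → ℕ) (wt : ι → YoungDiagram → A)

theorem BS_empty (M : ℕ → YoungDiagram) (lab : ℕ → ℕ) (m : ℕ) :
    BS t wt ∅ M lab m = if m = 0 then 1 else 0 := by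
  unfold BS
  cases m with
  | zero => simp
  | succ m => simp

theorem filter_lt_min {c : ι} {S B : Finset ι} (h : ∀ d ∈ S, c < d) (hB : B ⊆ S) : B.filter (· < c) = ∅ := by
  ext d; simp only [Finset.mem_filter, Finset.notMem_empty, iff_false]
  rintro ⟨h1, h2⟩; exact lt_asymm h2 (h d (hB h1))

theorem BS_step0 (c : ι) (S : Finset ι) (h : ∀ d ∈ S, c < d) (M : ℕ → YoungDiagram) (lab : ℕ → ℕ) :
    BS t wt (insert c S) M lab 0 = wt c (M 0) * BS t wt S M lab 0 := by
  have hcS : c ∉ S := fun hc => lt_irrefl _ (h c hc)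
  unfold BS
  simp [Finset.prod_insert hcS]

theorem BS_stepS (c : ι) (S : Finset ι) (h : ∀ d ∈ S, c < d) (M : ℕ → YoungDiagram) (lab : ℕ → ℕ) (m : ℕ) :
    BS t wt (insert c S) M lab (m + 1) = wt c (M 0) * BS t wt S M lab (m + 1) +
      (if t c = lab 0 then BS t wt S (fun i => M (i + 1)) (fun i => lab (i + 1)) m else 0) := by
  have hcS : c ∉ S := fun hc => lt_irrefl _ (h c hc)
  unfold BS
  rw [Finset.powersetCard_succ_insert hcS, Finset.sum_union]
  · congr 1
    · rw [Finset.mul_sum]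
      apply Finset.sum_congr rfl
      intro B hB
      have hBS := (Finset.mem_powersetCard.1 hB).1
      rw [Finset.prod_insert hcS, if_neg (fun hc => hcS (hBS hc)), filter_lt_min h hBS]
      simp
    · rw [Finset.sum_image]
      · rw [← boole_mul, Finset.mul_sum]
        apply Finset.sum_congr rfl
        intro B hB
        have hBS := (Finset.mem_powersetCard.1 hB).1
        have hcB : c ∉ B := fun hc => hcS (hBS hc)
        rw [Finset.prod_insert hcS, if_pos (Finset.mem_insert_self _ _), Finset.filter_insert,
          if_neg (lt_irrefl c), filter_lt_min h hBS, Finset.card_empty]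
        congr 1
        apply Finset.prod_congr rfl
        intro d hd
        have hcd := h d hd
        rw [Finset.filter_insert, if_pos hcd, Finset.card_insert_of_notMem (by simp [hcB])]
        simp only [Finset.mem_insert, hcd.ne', false_or]
      · intro B hB B' hB' e
        have hB := (Finset.mem_powersetCard.1 hB).1
        have hB' := (Finset.mem_powersetCard.1 hB').1
        have hcB : c ∉ B := fun hc => hcS (hB hc)
        have hcB' : c ∉ B' := fun hc => hcS (hB' hc)
        rw [← Finset.erase_insert hcB, ← Finset.erase_insert hcB', e]
  · rw [Finset.disjoint_left]
    intro B h1 h2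
    have hB := (Finset.mem_powersetCard.1 h1).1
    simp only [Finset.mem_image] at h2
    obtain ⟨B', -, rfl⟩ := h2
    exact hcS (hB (Finset.mem_insert_self _ _))

end Bars

section Match
variable {ι : Type} [LinearOrder ι] {A : Type} [CommRing A] {n : ℕ} {ν : YoungDiagram}

theorem CSf_mul (l : ℕ) (x : A) (F : List YoungDiagram → A) (ρ : YoungDiagram) :
    CSf n ν l (fun L => x * F L) ρ = x * CSf n ν l F ρ := by
  unfold CSf; rw [Finset.mul_sum]

theorem CSf_add (l : ℕ) (F F' : List YoungDiagram → A) (ρ : YoungDiagram) :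
    CSf n ν l (fun L => F L + F' L) ρ = CSf n ν l F ρ + CSf n ν l F' ρ := by
  unfold CSf; rw [Finset.sum_add_distrib]

theorem CSf_tail (l : ℕ) (F : List YoungDiagram → A) :
    CSf n ν (l + 1) (fun L => F L.tail) = Eall A n (CSf n ν l F) := by
  ext ρ
  rw [CSf_succ]
  unfold Eall
  rw [LinearMap.sum_apply, Finset.sum_apply]
  rfl

theorem CSf_pick (l : ℕ) (F : List YoungDiagram → A) (v : Fin n) :
    CSf n ν (l + 1) (fun L => if (v : ℕ) = stepRow (L.getD 0 ⊥) (L.getD 1 ⊥) then F L.tail else 0)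
      = Eop A v (CSf n ν l F) := by
  classical
  ext ρ
  rw [CSf_succ, Finset.sum_eq_single v]
  · rw [Eop_apply]
    split_ifs with h
    · apply CSf_congr
      intro L' _
      simp only [List.getD_cons_zero, List.getD_cons_succ, stepRow_addBox h, if_true, List.tail_cons]
    · rfl
  · intro r _ hr
    split_ifs with h
    · unfold CSf
      apply Finset.sum_eq_zero
      intro L hL
      obtain ⟨L', rfl⟩ := chainF_head hL
      simp only [List.getD_cons_zero, List.getD_cons_succ, stepRow_addBox h]
      rw [if_neg]
      intro e; exact hr (Fin.ext e.symm)
    · rfl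
  · intro h; exact absurd (Finset.mem_univ _) h

theorem Yop_apply (a : ℤ → A) (r : Fin n) (β : A) (g : YoungDiagram → A) (ρ : YoungDiagram) :
    Yop a r β g ρ = (a (pos n ρ r) - β) * g ρ + Eop A r g ρ := by
  unfold Yop
  simp only [LinearMap.sub_apply, LinearMap.add_apply, Pi.sub_apply, Pi.add_apply, Xop_apply,
    Module.algebraMap_end_apply, Pi.smul_apply, smul_eq_mul]
  ring

theorem Eop_congr {g g' : YoungDiagram → A} {ρ : YoungDiagram} (r : Fin n) (hρ : ρ.colLen 0 ≤ n)
    (h : ∀ σ : YoungDiagram, σ.colLen 0 ≤ n → σ.card = ρ.card + 1 → g σ = g' σ) :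
    Eop A (r : ℕ) g ρ = Eop A (r : ℕ) g' ρ := by
  rw [Eop_apply, Eop_apply]
  split_ifs with hA
  · exact h _ (colLen_addBox hA r.2 hρ) (card_addBox hA)
  · rfl

theorem Eall_congr {g g' : YoungDiagram → A} {ρ : YoungDiagram} (hρ : ρ.colLen 0 ≤ n)
    (h : ∀ σ : YoungDiagram, σ.colLen 0 ≤ n → σ.card = ρ.card + 1 → g σ = g' σ) :
    Eall A n g ρ = Eall A n g' ρ := by
  unfold Eall
  rw [LinearMap.sum_apply, Finset.sum_apply, LinearMap.sum_apply, Finset.sum_apply]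
  exact Finset.sum_congr rfl (fun r _ => Eop_congr r hρ h)

variable (a : ℤ → A) (T : ι → Fin n) (β : ι → A)

theorem vanish (s : ℕ) (g : YoungDiagram → A)
    (hg : ∀ ρ : YoungDiagram, ρ.colLen 0 ≤ n → ν.card < ρ.card + s → g ρ = 0) (S : Finset ι) :
    ∀ ρ : YoungDiagram, ρ.colLen 0 ≤ n → ν.card < ρ.card + s →
      oprod (fun c => Yop a (T c) (β c)) S g ρ = 0 := by
  induction S using Finset.induction_on_min with
  | empty => simpa [oprod_empty] using hg
  | insert c S hc ih =>
    intro ρ h1 h2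
    rw [oprod_insert _ _ _ hc, Module.End.mul_apply, Yop_apply, ih ρ h1 h2, mul_zero, zero_add,
      Eop_congr (g' := 0) _ h1]
    · simp
    · intro σ h3 h4; exact ih σ h3 (by omega)

/-- weight of unbarred cells -/
def wt (a : ℤ → A) (T : ι → Fin n) (β : ι → A) (c : ι) (ρ : YoungDiagram) : A := a (pos n ρ (T c)) - β c

noncomputable def fullB (S : Finset ι) (l : ℕ) (L : List YoungDiagram) : A :=
  BS (fun c => (T c : ℕ)) (wt a T β) S (fun i => L.getD i ⊥)
    (fun i => stepRow (L.getD i ⊥) (L.getD (i + 1) ⊥)) l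

theorem claimA (g0 : YoungDiagram → A) [DecidableEq YoungDiagram]
    (hg0 : ∀ ρ : YoungDiagram, ρ.colLen 0 ≤ n → g0 ρ = if ρ = ν then 1 else 0) (S : Finset ι) :
    ∀ (l : ℕ) (ρ : YoungDiagram), ρ.colLen 0 ≤ n → ρ.card + l = ν.card →
      CSf n ν l (fullB a T β S l) ρ = oprod (fun c => Yop a (T c) (β c)) S g0 ρ := by
  have hv : ∀ ρ : YoungDiagram, ρ.colLen 0 ≤ n → ν.card < ρ.card + 0 → g0 ρ = 0 := by
    intro ρ h1 h2
    rw [hg0 ρ h1, if_neg]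
    rintro rfl; omega
  induction S using Finset.induction_on_min with
  | empty =>
    intro l ρ h1 h2
    simp only [oprod_empty, Module.End.one_apply, hg0 ρ h1]
    unfold CSf fullB
    simp only [BS_empty]
    cases l with
    | zero =>
      unfold chainF
      by_cases h : ρ = ν
      · simp [h]
      · simp [h]
    | succ l =>
      have : ρ ≠ ν := by rintro rfl; omega
      simp [this]
  | insert c S hc ih =>
    intro l ρ h1 h2
    rw [oprod_insert _ _ _ hc, Module.End.mul_apply, Yop_apply]
    cases l with
    | zero =>
      rw [Eop_congr (g' := 0) _ h1, map_zero, Pi.zero_apply, add_zero, ← ih 0 ρ h1 h2, ← CSf_mul]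
      · apply CSf_congr
        intro L' _
        unfold fullB
        rw [BS_step0 _ _ _ _ hc]
        rfl
      · intro σ h3 h4
        exact vanish a T β 0 g0 hv S σ h3 (by omega)
    | succ l =>
      have e : Eop A (T c : ℕ) ((oprod (fun c => Yop a (T c) (β c)) S) g0) ρ =
          Eop A (T c : ℕ) (CSf n ν l (fullB a T β S l)) ρ := by
        apply Eop_congr _ h1
        intro σ h3 h4
        exact (ih l σ h3 (by omega)).symm
      rw [e, ← CSf_pick, ← ih (l + 1) ρ h1 h2, ← CSf_mul, ← CSf_add]
      apply CSf_congr
      intro L' _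
      unfold fullB
      rw [BS_stepS _ _ _ _ hc]
      rfl

def SM (k : ℕ) (L : List YoungDiagram) (cnt : ℕ) : YoungDiagram :=
  L.getD (if cnt < k then cnt else cnt + 1) ⊥

def ub (j t : ℕ) : ℕ := if t + 1 < j then t else t + 1

def lb (j : ℕ) (L : List YoungDiagram) (t : ℕ) : ℕ :=
  stepRow (L.getD (ub j t) ⊥) (L.getD (ub j t + 1) ⊥)

noncomputable def BB (S : Finset ι) (k j m : ℕ) (L : List YoungDiagram) : A :=
  BS (fun c => (T c : ℕ)) (wt a T β) S (SM k L) (lb j L) m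

theorem getD_tail (L : List YoungDiagram) (i : ℕ) : L.tail.getD i ⊥ = L.getD (i + 1) ⊥ := by
  cases L <;> simp

theorem SM_tail (k : ℕ) (L : List YoungDiagram) : (fun i => SM (k + 1) L (i + 1)) = SM k L.tail := by
  ext1 i
  unfold SM
  rw [getD_tail]
  congr 1
  split_ifs <;> omega

theorem lb_tail (j : ℕ) (L : List YoungDiagram) : (fun i => lb (j + 1) L (i + 1)) = lb j L.tail := by
  ext1 i
  unfold lb
  rw [getD_tail, getD_tail]
  have : ub (j + 1) (i + 1) = ub j i + 1 := by unfold ub; split_ifs <;> omega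
  rw [this]

/-- the commutator half -/
noncomputable def Qs (O : Fin n → Module.End A (YoungDiagram → A)) (g0 : YoungDiagram → A) (S : Finset ι) :
    YoungDiagram → A :=
  ∑ α ∈ S, oprod (fun c => Yop a (T c) (β c)) (S.filter (· < α))
    (O (T α) (oprod (fun c => Yop a (T c) (β c)) (S.filter (α < ·)) g0))

theorem Qs_insert (O : Fin n → Module.End A (YoungDiagram → A)) (g0 : YoungDiagram → A) (c : ι)
    (S : Finset ι) (hc : ∀ d ∈ S, c < d) :
    Qs a T β O g0 (insert c S) = Yop a (T c) (β c) (Qs a T β O g0 S) +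
      O (T c) (oprod (fun c => Yop a (T c) (β c)) S g0) := by
  have hcS : c ∉ S := fun h => lt_irrefl _ (hc c h)
  unfold Qs
  rw [Finset.sum_insert hcS, add_comm, map_sum]
  congr 1
  · apply Finset.sum_congr rfl
    intro α hα
    rw [Finset.filter_insert, if_pos (hc α hα), Finset.filter_insert, if_neg (hc α hα).not_gt,
      oprod_insert _ _ _ (fun d hd => hc d (Finset.mem_filter.1 hd).1)]
    rfl
  · have e1 : (insert c S).filter (· < c) = ∅ := by
      rw [Finset.filter_insert, if_neg (lt_irrefl c)]; exact filter_lt_min hc (Finset.Subset.refl S)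
    have e2 : (insert c S).filter (c < ·) = S := by
      rw [Finset.filter_insert, if_neg (lt_irrefl c)]; exact Finset.filter_true_of_mem hc
    rw [e1, e2, oprod_empty]; rfl

theorem claimB (g0 : YoungDiagram → A) [DecidableEq YoungDiagram]
    (hg0 : ∀ ρ : YoungDiagram, ρ.colLen 0 ≤ n → g0 ρ = if ρ = ν then 1 else 0)
    (O : Fin n → Module.End A (YoungDiagram → A)) (d : ℕ) (hd : d ≤ 1)
    (hO : ∀ (v : Fin n) (l : ℕ) (F : List YoungDiagram → A),
      CSf n ν (l + 2) (fun L => if (v : ℕ) = lb (1 + d) L 0 then F L.tail.tail else 0) = O v (CSf n ν l F))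
    (hOc : ∀ (v : Fin n) (g g' : YoungDiagram → A) (ρ : YoungDiagram), ρ.colLen 0 ≤ n →
      (∀ σ : YoungDiagram, σ.colLen 0 ≤ n → σ.card = ρ.card + 2 → g σ = g' σ) → O v g ρ = O v g' ρ)
    (S : Finset ι) :
    ∀ (l : ℕ) (ρ : YoungDiagram), ρ.colLen 0 ≤ n → ρ.card + l = ν.card →
      ∑ k ∈ Finset.range (l - 1), CSf n ν l (BB a T β S (k + 1) (k + 1 + d) (l - 1)) ρ =
        Qs a T β O g0 S ρ := by
  have hv : ∀ ρ : YoungDiagram, ρ.colLen 0 ≤ n → ν.card < ρ.card + 0 → g0 ρ = 0 := by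
    intro ρ h1 h2
    rw [hg0 ρ h1, if_neg]
    rintro rfl; omega
  induction S using Finset.induction_on_min with
  | empty =>
    intro l ρ h1 h2
    unfold Qs
    rw [Finset.sum_empty]
    apply Finset.sum_eq_zero
    intro k hk
    rw [Finset.mem_range] at hk
    unfold CSf BB
    simp only [BS_empty]
    rw [if_neg (by omega)]
    simp
  | insert c S hc ih =>
    intro l ρ h1 h2
    match l, h2 with
    | 0, h2 =>
      symm
      unfold Qs
      rw [Finset.sum_apply]
      apply Finset.sum_eq_zero
      intro α _
      apply vanish (ν := ν) a T β 2 _ _ _ ρ h1 (by omega)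
      intro σ h3 h4
      rw [hOc _ _ 0 σ h3]
      · simp
      · intro τ h5 h6; exact vanish a T β 0 g0 hv _ τ h5 (by omega)
    | 1, h2 =>
      symm
      unfold Qs
      rw [Finset.sum_apply]
      apply Finset.sum_eq_zero
      intro α _
      apply vanish (ν := ν) a T β 2 _ _ _ ρ h1 (by omega)
      intro σ h3 h4
      rw [hOc _ _ 0 σ h3]
      · simp
      · intro τ h5 h6; exact vanish a T β 0 g0 hv _ τ h5 (by omega)
    | l + 2, h2 =>
      have step : ∀ k : ℕ, CSf n ν (l + 2) (BB a T β (insert c S) (k + 1) (k + 1 + d) (l + 1)) ρ =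
          (a (pos n ρ (T c)) - β c) * CSf n ν (l + 2) (BB a T β S (k + 1) (k + 1 + d) (l + 1)) ρ +
          CSf n ν (l + 2) (fun L => if (T c : ℕ) = lb (k + 1 + d) L 0 then
            BS (fun c => (T c : ℕ)) (wt a T β) S (SM k L.tail) (lb (k + d) L.tail) l else 0) ρ := by
        intro k
        rw [← CSf_mul, ← CSf_add]
        apply CSf_congr
        intro L' _
        unfold BB
        rw [BS_stepS _ _ _ _ hc, SM_tail, Nat.add_right_comm k 1 d, lb_tail]
        rfl
      have e1 : l + 2 - 1 = l + 1 := rfl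
      rw [Qs_insert _ _ _ _ _ _ _ hc, Pi.add_apply, Yop_apply, ← ih (l + 2) ρ h1 h2, e1]
      simp only [step]
      rw [Finset.sum_add_distrib, ← Finset.mul_sum, add_assoc]
      congr 1
      rw [Finset.sum_range_succ']
      congr 1
      · have e2 : Eop A (T c : ℕ) (Qs a T β O g0 S) ρ = Eop A (T c : ℕ)
          (∑ k ∈ Finset.range l, CSf n ν (l + 1) (BB a T β S (k + 1) (k + 1 + d) l)) ρ := by
          apply Eop_congr _ h1
          intro σ h3 h4
          rw [← ih (l + 1) σ h3 (by omega), Finset.sum_apply]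
          rfl
        rw [e2, map_sum, Finset.sum_apply]
        apply Finset.sum_congr rfl
        intro k _
        rw [← CSf_pick]
        apply CSf_congr
        intro L' _
        have e3 : lb (k + 1 + 1 + d) (ρ :: L') 0 = stepRow ((ρ :: L').getD 0 ⊥) ((ρ :: L').getD 1 ⊥) := by
          unfold lb ub; rw [if_pos (by omega)]
        rw [e3]
        rfl
      · have e4 : O (T c) ((oprod (fun c => Yop a (T c) (β c)) S) g0) ρ =
            O (T c) (CSf n ν l (fullB a T β S l)) ρ := by
          apply hOc _ _ _ _ h1
          intro σ h3 h4
          exact (claimA a T β g0 hg0 S l σ h3 (by omega)).symm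
        rw [e4, ← hO]
        apply CSf_congr
        intro L' _
        rw [zero_add 1, zero_add d]
        congr 1
        unfold fullB
        congr 1
        · ext1 i
          rw [getD_tail, List.tail_cons]; rfl
        · ext1 i
          unfold lb ub
          rw [if_neg (by omega)]
          simp only [getD_tail]

theorem hO_minus (v : Fin n) (l : ℕ) (F : List YoungDiagram → A) :
    CSf n ν (l + 2) (fun L => if (v : ℕ) = lb (1 + 0) L 0 then F L.tail.tail else 0) =
      (Eall A n * Eop A (v : ℕ)) (CSf n ν l F) := by
  rw [Module.End.mul_apply, ← CSf_pick, ← CSf_tail]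
  ext ρ
  apply CSf_congr
  intro L' _
  rfl

theorem hO_plus (v : Fin n) (l : ℕ) (F : List YoungDiagram → A) :
    CSf n ν (l + 2) (fun L => if (v : ℕ) = lb (1 + 1) L 0 then F L.tail.tail else 0) =
      (Eop A (v : ℕ) * Eall A n) (CSf n ν l F) := by
  rw [Module.End.mul_apply, ← CSf_tail, ← CSf_pick]
  ext ρ
  apply CSf_congr
  intro L' _
  rfl

theorem hOc_minus (v : Fin n) (g g' : YoungDiagram → A) (ρ : YoungDiagram) (h : ρ.colLen 0 ≤ n)
    (hg : ∀ σ : YoungDiagram, σ.colLen 0 ≤ n → σ.card = ρ.card + 2 → g σ = g' σ) :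
    (Eall A n * Eop A (v : ℕ)) g ρ = (Eall A n * Eop A (v : ℕ)) g' ρ := by
  rw [Module.End.mul_apply, Module.End.mul_apply]
  apply Eall_congr h
  intro σ h1 h2
  apply Eop_congr _ h1
  intro τ h3 h4
  exact hg τ h3 (by omega)

theorem hOc_plus (v : Fin n) (g g' : YoungDiagram → A) (ρ : YoungDiagram) (h : ρ.colLen 0 ≤ n)
    (hg : ∀ σ : YoungDiagram, σ.colLen 0 ≤ n → σ.card = ρ.card + 2 → g σ = g' σ) :
    (Eop A (v : ℕ) * Eall A n) g ρ = (Eop A (v : ℕ) * Eall A n) g' ρ := by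
  rw [Module.End.mul_apply, Module.End.mul_apply]
  apply Eop_congr _ h
  intro σ h1 h2
  apply Eall_congr h1
  intro τ h3 h4
  exact hg τ h3 (by omega)

end Match

section Bars
variable {ι : Type} [LinearOrder ι] [Fintype ι] {A : Type} [CommRing A]

open Classical in
theorem BS_eq (tt : ι → ℕ) (wt : ι → YoungDiagram → A) (M : ℕ → YoungDiagram) (lab : ℕ → ℕ) (m : ℕ) :
    (∑ β : Fin m → ι, if StrictMono β ∧ ∀ t, tt (β t) = lab t then
      ∏ c, (if ∃ t, β t = c then 1 else wt c (M (Finset.univ.filter (fun t => β t < c)).card)) else 0) =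
    BS tt wt Finset.univ M lab m := by
  have key : ∀ β : Fin m → ι, StrictMono β → ∀ c, ((Finset.univ.image β).filter (· < c)).card =
      (Finset.univ.filter (fun t => β t < c)).card := by
    intro β hβ c
    rw [Finset.filter_image, Finset.card_image_of_injective _ hβ.injective]
  have key2 : ∀ β : Fin m → ι, StrictMono β → ∀ u, (Finset.univ.filter (fun t => β t < β u)).card = (u : ℕ) := by
    intro β hβ u
    simp only [hβ.lt_iff_lt]
    have : Finset.univ.filter (fun t => t < u) = Finset.Iio u := by ext; simp
    rw [this, Fin.card_Iio]
  have e1 : ∀ β : Fin m → ι, (if StrictMono β ∧ ∀ t, tt (β t) = lab t then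
      ∏ c, (if ∃ t, β t = c then 1 else wt c (M (Finset.univ.filter (fun t => β t < c)).card)) else 0) =
      if StrictMono β then ∏ c, (if c ∈ Finset.univ.image β then
        (if tt c = lab ((Finset.univ.image β).filter (· < c)).card then 1 else 0)
        else wt c (M ((Finset.univ.image β).filter (· < c)).card)) else 0 := by
    intro β
    by_cases hβ : StrictMono β
    · simp only [hβ, true_and, if_true, key β hβ]
      by_cases hl : ∀ t, tt (β t) = lab t
      · rw [if_pos hl]
        apply Finset.prod_congr rfl
        intro c _
        by_cases hc : ∃ t, β t = c
        · obtain ⟨t, rfl⟩ := hc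
          simp [key2 β hβ, hl]
        · rw [if_neg hc, if_neg]
          simpa using hc
      · rw [if_neg hl]
        push Not at hl
        obtain ⟨t, ht⟩ := hl
        symm
        apply Finset.prod_eq_zero (Finset.mem_univ (β t))
        rw [if_pos (by simp), key2 β hβ, if_neg ht]
    · simp [hβ]
  rw [Finset.sum_congr rfl (fun β _ => e1 β), ← Finset.sum_filter]
  unfold BS
  apply Finset.sum_bij (fun β _ => Finset.univ.image β)
  · intro β hβ
    rw [Finset.mem_filter] at hβ
    rw [Finset.mem_powersetCard_univ, Finset.card_image_of_injective _ hβ.2.injective]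
    simp
  · intro β hβ γ hγ h
    rw [Finset.mem_filter] at hβ hγ
    apply (StrictMono.range_inj hβ.2 hγ.2).1
    have := congrArg (fun s : Finset ι => (s : Set ι)) h
    simpa using this
  · intro B hB
    rw [Finset.mem_powersetCard_univ] at hB
    refine ⟨B.orderEmbOfFin hB, ?_, ?_⟩
    · simp [OrderEmbedding.strictMono]
    · simp
  · intro β hβ
    apply Finset.prod_congr rfl
    intro c _
    congr
end Bars

/-- Cells in column order. -/
def Idx (s : Finset (ℕ × ℕ)) : Type := {c // c ∈ s}

instance (s : Finset (ℕ × ℕ)) : Fintype (Idx s) := inferInstanceAs (Fintype {c // c ∈ s})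

/-- embedding -/
def Idx.key {s : Finset (ℕ × ℕ)} (c : Idx s) : ℕᵒᵈ ×ₗ ℕ := toLex (OrderDual.toDual c.1.2, c.1.1)

theorem Idx.key_inj {s : Finset (ℕ × ℕ)} : Function.Injective (Idx.key (s := s)) := by
  rintro ⟨⟨a, b⟩, h⟩ ⟨⟨a', b'⟩, h'⟩ e
  simp only [Idx.key, EmbeddingLike.apply_eq_iff_eq, Prod.mk.injEq] at e
  apply Subtype.ext
  exact Prod.ext e.2 e.1

noncomputable instance (s : Finset (ℕ × ℕ)) : LinearOrder (Idx s) := LinearOrder.lift' Idx.key Idx.key_inj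

theorem Idx.lt_iff {s : Finset (ℕ × ℕ)} (c d : Idx s) : c < d ↔ ColLT c.1 d.1 := by
  change Idx.key c < Idx.key d ↔ _
  rw [Prod.Lex.lt_iff]
  unfold ColLT
  rfl

def Idx.rw {s : Finset (ℕ × ℕ)} (c : Idx s) : ℕ := c.1.1
def Idx.cl {s : Finset (ℕ × ℕ)} (c : Idx s) : ℕ := c.1.2

theorem geo_skew (θi θo : YoungDiagram) :
    Geo (Idx.rw (s := skewCells θi θo)) (Idx.cl (s := skewCells θi θo)) := by
  constructor
  · intro c d; rw [Idx.lt_iff]; rfl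
  · intro c d i j h1 h2 h3 h4
    have hm : (i, j) ∈ skewCells θi θo := by
      have hc := c.2
      have hd := d.2
      unfold skewCells at hc hd ⊢
      rw [Finset.mem_sdiff] at hc hd ⊢
      refine ⟨θo.isLowerSet (show (i, j) ≤ d.1 from ⟨h2, h4⟩) hd.1, fun h => hc.2 ?_⟩
      exact θi.isLowerSet (show c.1 ≤ (i, j) from ⟨h1, h3⟩) h
    exact ⟨⟨(i, j), hm⟩, rfl, rfl⟩

/-- The `b`-weight of a cell. -/
def bw {A : Type} {n : ℕ} {s : Finset (ℕ × ℕ)} (b : ℤ → A) (T : Idx s → Fin n) (c : Idx s) : A :=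
  b ((T c : ℤ) + 1 + (Idx.cl c : ℤ) - (Idx.rw c : ℤ))

open Classical in
theorem Skbar_gen (pl : Bool) {A : Type} [CommRing A] (n : ℕ) (s : Finset (ℕ × ℕ))
    (a b : ℤ → A) (L : List YoungDiagram) (k k' m : ℕ) (hm : L.length - 1 - 1 = m)
    (hk : 1 ≤ k) (hpl : ∀ cnt, (if pl then rhoIdxP else rhoIdxM) k cnt = if cnt < k' then cnt else cnt + 1) :
    Skbar pl n s a b L k = ∑ T : Idx s → Fin n with Ss Idx.rw Idx.cl T,
      BB a T (bw b T) Finset.univ k' k m L := by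
  subst hm
  unfold Skbar
  have hs : TkSet (n := n) s L k = ↑(Finset.univ.filter (fun p => p ∈ TkSet (n := n) s L k)) := by
    ext p; simp
  rw [hs, finsum_mem_coe_finset, Finset.sum_filter, Fintype.sum_prod_type, Finset.sum_filter]
  refine Fintype.sum_equiv (ι := s → Fin n) (κ := Idx s → Fin n) (Equiv.refl _) _ _ fun T => ?_
  change _ = if Ss (Idx.rw (s := s)) Idx.cl T then BB (ι := Idx s) a T (bw b T) Finset.univ k' k (L.length - 1 - 1) L else 0
  by_cases hT : Ss (Idx.rw (s := s)) Idx.cl T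
  · rw [if_pos hT]
    unfold BB
    rw [← BS_eq]
    refine Fintype.sum_equiv (ι := Fin (L.length - 1 - 1) → s) (κ := Fin (L.length - 1 - 1) → Idx s)
      (Equiv.refl _) _ _ fun β => ?_
    have hiff : ((T, β) ∈ TkSet (n := n) s L k) ↔
        (StrictMono (β := Idx s) β ∧ ∀ t, ((T (β t) : Fin n) : ℕ) = lb k L t) := by
      constructor
      · rintro ⟨-, h2, h3⟩
        refine ⟨fun i j hij => (Idx.lt_iff _ _).2 (h2 i j hij), fun t => ?_⟩
        rw [h3 t]
        unfold lb ub skipIdx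
        split_ifs <;> rfl
      · rintro ⟨h2, h3⟩
        refine ⟨hT, fun i j hij => (Idx.lt_iff _ _).1 (h2 hij), fun t => ?_⟩
        refine (h3 t).trans ?_
        unfold lb ub skipIdx
        split_ifs <;> rfl
    refine if_congr hiff ?_ rfl
    refine Fintype.prod_equiv (ι := s) (κ := Idx s) (Equiv.refl _) _ _ fun c => ?_
    refine if_congr Iff.rfl rfl ?_
    have hf : (Finset.univ.filter (fun t : Fin (L.length - 1 - 1) =>
        ColLT (β t : ℕ × ℕ) (c : ℕ × ℕ))).card =
        (Finset.univ.filter (fun t : Fin (L.length - 1 - 1) => @LT.lt (Idx s) _ (β t) c)).card := by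
      congr 1
      ext t
      simp only [Finset.mem_filter, Finset.mem_univ, true_and]
      exact (Idx.lt_iff _ _).symm
    rw [hpl]
    simp only [hf]
    rfl
  · rw [if_neg hT]
    apply Finset.sum_eq_zero
    intro β _
    rw [if_neg]
    rintro ⟨h, -⟩
    exact hT h

theorem main_side {A : Type} [CommRing A] [IsDomain A] [CharZero A] (a b : ℤ → A) (n : ℕ) (pl : Bool) (d : ℕ) (s : Finset (ℕ × ℕ))
    [DecidablePred (fun T : Idx s → Fin n => Ss Idx.rw Idx.cl T)]
    (mu nu : YoungDiagram) (hmu : mu.colLen 0 ≤ n) (hnu : nu.colLen 0 ≤ n) (hsub : mu ≤ nu) (hd : d ≤ 1)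
    (hpl : ∀ k cnt, (if pl then rhoIdxP else rhoIdxM) (k + 1 + d) cnt = if cnt < k + 1 then cnt else cnt + 1)
    (O : Fin n → Module.End A (YoungDiagram → A))
    (hO : ∀ (v : Fin n) (l : ℕ) (F : List YoungDiagram → A),
      CSf n nu (l + 2) (fun L => if (v : ℕ) = lb (1 + d) L 0 then F L.tail.tail else 0) = O v (CSf n nu l F))
    (hOc : ∀ (v : Fin n) (g g' : YoungDiagram → A) (ρ : YoungDiagram), ρ.colLen 0 ≤ n →
      (∀ σ : YoungDiagram, σ.colLen 0 ≤ n → σ.card = ρ.card + 2 → g σ = g' σ) → O v g ρ = O v g' ρ) :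
    ∑ᶠ L ∈ chainSet mu nu, ∑ k ∈ Finset.range (nu.card - mu.card - 1),
      Skbar pl n s a b L (k + 1 + d) =
    (∑ T : Idx s → Fin n with Ss Idx.rw Idx.cl T,
      ∑ α, oprod (Yc Idx.rw Idx.cl a b T) (Finset.univ.filter (· < α))
      (O (T α) (oprod (Yc Idx.rw Idx.cl a b T) (Finset.univ.filter (α < ·)) (res (fdet A (pos n nu)))))) mu := by
  classical
  rw [chainSet_eq hnu, finsum_mem_coe_finset]
  have e : ∀ L ∈ chainF n nu (nu.card - mu.card) mu,
      ∑ k ∈ Finset.range (nu.card - mu.card - 1), Skbar pl n s a b L (k + 1 + d) =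
      ∑ T : Idx s → Fin n with Ss Idx.rw Idx.cl T, ∑ k ∈ Finset.range (nu.card - mu.card - 1),
        BB a T (bw b T) Finset.univ (k + 1) (k + 1 + d) (nu.card - mu.card - 1) L := by
    intro L hL
    rw [Finset.sum_comm]
    apply Finset.sum_congr rfl
    intro k _
    rw [Skbar_gen pl n s a b L (k + 1 + d) (k + 1) (nu.card - mu.card - 1)
      (by rw [chainF_length hL]; rfl) (by omega) (hpl k)]
    congr
  rw [Finset.sum_congr rfl e, Finset.sum_comm, Finset.sum_apply]
  apply Finset.sum_congr rfl
  intro T _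
  rw [Finset.sum_comm]
  have hc : mu.card ≤ nu.card := Finset.card_le_card hsub
  exact claimB a T (bw b T) (res (fdet A (pos n nu))) (fun ρ h => res_fdet hnu h) O d hd hO hOc
    Finset.univ (nu.card - mu.card) mu hmu (by omega)

/-- **Bijection identity:** `Σ_R Σ_{k=1}^{l−1} 𝒮_k^-(R) = Σ_R Σ_{k=2}^{l} 𝒮_k^+(R)`
in `ℤ[a_i, b_i : i ∈ ℤ]`, where `R` runs over all sequences `μ = ρ⁽⁰⁾ → ⋯ → ρ⁽ˡ⁾ = ν`. -/
theorem bijection_identity (n : ℕ) (hn : 1 ≤ n) (θi θo : YoungDiagram) (hθ : θi ≤ θo)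
    (mu nu : YoungDiagram) (hmu : mu.colLen 0 ≤ n) (hnu : nu.colLen 0 ≤ n) (hsub : mu ≤ nu)
    (hl : 1 ≤ nu.card - mu.card) :
    ∑ᶠ L ∈ chainSet mu nu,
      ∑ k ∈ Finset.Icc 1 (nu.card - mu.card - 1),
        Skbar false n (skewCells θi θo)
          (fun j => (MvPolynomial.X (Sum.inl j) : MvPolynomial (ℤ ⊕ ℤ) ℤ))
          (fun j => MvPolynomial.X (Sum.inr j)) L k =
    ∑ᶠ L ∈ chainSet mu nu,
      ∑ k ∈ Finset.Icc 2 (nu.card - mu.card),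
        Skbar true n (skewCells θi θo)
          (fun j => MvPolynomial.X (Sum.inl j))
          (fun j => MvPolynomial.X (Sum.inr j)) L k := by
  classical
  have e1 : ∀ f : ℕ → MvPolynomial (ℤ ⊕ ℤ) ℤ, ∑ k ∈ Finset.Icc 1 (nu.card - mu.card - 1), f k =
      ∑ k ∈ Finset.range (nu.card - mu.card - 1), f (k + 1 + 0) := by
    intro f
    rw [← Finset.Ico_add_one_right_eq_Icc, Finset.sum_Ico_eq_sum_range]
    apply Finset.sum_congr (by congr 1)
    intro k _; congr 1; omega
  have e2 : ∀ f : ℕ → MvPolynomial (ℤ ⊕ ℤ) ℤ, ∑ k ∈ Finset.Icc 2 (nu.card - mu.card), f k =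
      ∑ k ∈ Finset.range (nu.card - mu.card - 1), f (k + 1 + 1) := by
    intro f
    rw [← Finset.Ico_add_one_right_eq_Icc, Finset.sum_Ico_eq_sum_range]
    apply Finset.sum_congr (by congr 1)
    intro k _; congr 1; omega
  simp only [e1, e2]
  rw [main_side _ _ n false 0 (skewCells θi θo) mu nu hmu hnu hsub (by omega) _
      (fun v => Eall _ n * Eop _ (v : ℕ)) hO_minus hOc_minus,
    main_side _ _ n true 1 (skewCells θi θo) mu nu hmu hnu hsub (by omega) _
      (fun v => Eop _ (v : ℕ) * Eall _ n) hO_plus hOc_plus]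
  · apply congrFun
    have hAS : AS (fdet (MvPolynomial (ℤ ⊕ ℤ) ℤ) (pos n nu)) := by
      intro lo hi h
      apply fdet_ASw
      rintro rfl
      omega
    exact (comm_identity _ _ (geo_skew θi θo) _ hAS).symm
  · intro k cnt
    simp only [if_true]
    unfold rhoIdxP
    split_ifs <;> omega
  · intro k cnt
    simp only [Bool.false_eq_true, if_false]
    unfold rhoIdxM
    split_ifs <;> omega

end FactorialLR
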